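/- arXiv:1001.1466 — 2 statements merged into one kernel-verified Lean document; each statement's English description precedes it below -/
import Mathlib

section
/- Let K be a field and q ∈ K an element that is not a root of unity. Then the quantum plane B(q) does not satisfy property (⋄): there exists a finitely generated (indeed cyclic) monolithic left B(q)-module that is not Artinian. -/
noncomputable section

open FreeAlgebra

/-- Defining relation of the quantum plane `B(q)`: `a * b = q • (b * a)`, where
`ι K 0` plays the role of `a` and `ι K 1` plays the role of `b`. -/
inductive QuantumPlaneRel (K : Type) [Field K] (q : K) :
    FreeAlgebra K (Fin 2) → FreeAlgebra K (Fin 2) → Prop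
  | rel : QuantumPlaneRel K q (ι K (0 : Fin 2) * ι K (1 : Fin 2))
      (q • (ι K (1 : Fin 2) * ι K (0 : Fin 2)))

/-- The coordinate algebra of the quantum plane `B(q)`. -/
abbrev QuantumPlane (K : Type) [Field K] (q : K) : Type :=
  RingQuot (QuantumPlaneRel K q)

/-- The generator `a` of the quantum plane. -/
def QuantumPlane.a (K : Type) [Field K] (q : K) : QuantumPlane K q :=
  RingQuot.mkAlgHom K (QuantumPlaneRel K q) (ι K (0 : Fin 2))

/-- The generator `b` of the quantum plane. -/
def QuantumPlane.b (K : Type) [Field K] (q : K) : QuantumPlane K q :=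
  RingQuot.mkAlgHom K (QuantumPlaneRel K q) (ι K (1 : Fin 2))

/-- A witness to the failure of property `(⋄)` for the ring `B`, with a cyclic module:
a cyclic (hence finitely generated) left `B`-module that is monolithic — it has a
simple submodule which is essential, i.e., meets every nonzero submodule nontrivially —
but is not Artinian. -/
structure CyclicMonolithicNonArtinianModule (B : Type) [Ring B] where
  /-- The underlying module. -/
  M : Type
  /-- `M` is an abelian group. -/
  [isAddCommGroup : AddCommGroup M]
  /-- `M` is a left `B`-module. -/
  [isModule : Module B M]
  /-- `M` is cyclic (in particular finitely generated). -/
  cyclic : ∃ m : M, Submodule.span B {m} = ⊤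
  /-- The monolith: a submodule of `M`. -/
  monolith : Submodule B M
  /-- The monolith is a simple module. -/
  monolith_simple : IsSimpleModule B monolith
  /-- The monolith is essential in `M`. -/
  monolith_essential : ∀ N : Submodule B M, N ≠ ⊥ → N ⊓ monolith ≠ ⊥
  /-- `M` is not Artinian. -/
  not_artinian : ¬ IsArtinian B M

attribute [instance] CyclicMonolithicNonArtinianModule.isAddCommGroup
  CyclicMonolithicNonArtinianModule.isModule

namespace QuantumPlane

open Finsupp

variable {K : Type} [Field K] (q : K)

/-- A vector space with basis `e i = single (inl i) 1` for `i : ℤ` and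
`f n = single (inr n) 1` for `n : ℕ`. -/
abbrev Carrier (K : Type) [Field K] : Type := (ℤ ⊕ ℕ) →₀ K

/-- The action of `a`: `e i ↦ q ^ i • e (i - 1)` and `f n ↦ q ^ n • (f n + e n)`. -/
def aEnd : Module.End K (Carrier K) :=
  linearCombination K (Sum.elim (fun i => single (Sum.inl (i - 1)) (q ^ i))
    (fun n => single (Sum.inr n) (q ^ n) + single (Sum.inl (n : ℤ)) (q ^ n)))

/-- The action of `b`: `e i ↦ e (i + 1)` and `f n ↦ f (n + 1)`. -/
def bEnd : Module.End K (Carrier K) :=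
  linearCombination K (Sum.elim (fun i => single (Sum.inl (i + 1)) 1)
    (fun n => single (Sum.inr (n + 1)) 1))

lemma aEnd_inl (i : ℤ) (c : K) :
    aEnd q (single (Sum.inl i) c) = single (Sum.inl (i - 1)) (c * q ^ i) := by
  simp [aEnd]

lemma aEnd_inr (n : ℕ) (c : K) :
    aEnd q (single (Sum.inr n) c) =
      single (Sum.inr n) (c * q ^ n) + single (Sum.inl (n : ℤ)) (c * q ^ n) := by
  simp [aEnd]

lemma bEnd_inl (i : ℤ) (c : K) :
    bEnd (single (Sum.inl i) c) = single (Sum.inl (i + 1)) c := by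
  simp [bEnd]

lemma bEnd_inr (n : ℕ) (c : K) :
    bEnd (single (Sum.inr n) c) = single (Sum.inr (n + 1)) c := by
  simp [bEnd]

lemma aEnd_mul_bEnd (hq0 : q ≠ 0) : aEnd q * bEnd = q • (bEnd * aEnd q) := by
  refine lhom_ext fun x c => ?_
  rcases x with i | n
  · simp only [Module.End.mul_apply, LinearMap.smul_apply, bEnd_inl, aEnd_inl, smul_single,
      smul_eq_mul, add_sub_cancel_right, sub_add_cancel, zpow_add_one₀ hq0]
    congr 1; ring
  · simp only [Module.End.mul_apply, LinearMap.smul_apply, bEnd_inl, bEnd_inr, aEnd_inr, map_add,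
      smul_add, smul_single, smul_eq_mul, Nat.cast_add, Nat.cast_one, pow_succ]
    congr 2 <;> ring

lemma aEnd_apply_inr (v : Carrier K) (n : ℕ) :
    aEnd q v (Sum.inr n) = q ^ n * v (Sum.inr n) := by
  induction v using Finsupp.induction_linear with
  | zero => simp
  | add f g hf hg => simp [hf, hg, mul_add]
  | single x c =>
    rcases x with i | m
    · simp [aEnd_inl]
    · rw [aEnd_inr]
      by_cases h : m = n
      · subst h; simp [mul_comm]
      · simp [h]

lemma aEnd_apply_inl (v : Carrier K) (j : ℤ) :
    aEnd q v (Sum.inl j) = q ^ (j + 1) * v (Sum.inl (j + 1)) +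
      q ^ j * (if 0 ≤ j then v (Sum.inr j.toNat) else 0) := by
  induction v using Finsupp.induction_linear with
  | zero => simp
  | add f g hf hg => simp only [map_add, Finsupp.add_apply, hf, hg]; split_ifs <;> ring
  | single x c =>
    rcases x with i | m
    · rw [aEnd_inl]
      by_cases h : i = j + 1
      · subst h; simp [mul_comm]
      · have h' : i - 1 ≠ j := fun e => h (by omega)
        simp [h, h']
    · rw [aEnd_inr]
      by_cases h : (m : ℤ) = j
      · subst h; simp [mul_comm]
      · have h' : 0 ≤ j → m ≠ j.toNat := fun e => by omega
        by_cases h0 : 0 ≤ j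
        · simp [h, h' h0, h0]
        · simp [h, h0]

lemma bEnd_apply_inl (v : Carrier K) (j : ℤ) :
    bEnd v (Sum.inl j) = v (Sum.inl (j - 1)) := by
  induction v using Finsupp.induction_linear with
  | zero => simp
  | add f g hf hg => simp [hf, hg]
  | single x c =>
    rcases x with i | m
    · simp only [bEnd_inl, single_apply, Sum.inl.injEq, eq_sub_iff_add_eq]
    · simp [bEnd_inr]

lemma bEnd_apply_inr_zero (v : Carrier K) : bEnd v (Sum.inr 0) = 0 := by
  induction v using Finsupp.induction_linear with
  | zero => simp
  | add f g hf hg => simp [hf, hg]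
  | single x c => rcases x with i | m <;> simp [bEnd_inl, bEnd_inr]

lemma bEnd_apply_inr_succ (v : Carrier K) (n : ℕ) :
    bEnd v (Sum.inr (n + 1)) = v (Sum.inr n) := by
  induction v using Finsupp.induction_linear with
  | zero => simp
  | add f g hf hg => simp [hf, hg]
  | single x c => rcases x with i | m <;> simp [bEnd_inl, bEnd_inr, single_apply]

/-- The representation of the quantum plane given by `aEnd` and `bEnd`. -/
def rep (hq0 : q ≠ 0) : QuantumPlane K q →ₐ[K] Module.End K (Carrier K) :=
  RingQuot.liftAlgHom K ⟨FreeAlgebra.lift K ![aEnd q, bEnd], by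
    rintro _ _ ⟨⟩
    simpa using aEnd_mul_bEnd q hq0⟩

lemma rep_mk (hq0 : q ≠ 0) (y : FreeAlgebra K (Fin 2)) :
    rep q hq0 (RingQuot.mkAlgHom K _ y) = FreeAlgebra.lift K ![aEnd q, bEnd] y :=
  RingQuot.liftAlgHom_mkAlgHom_apply ..

lemma rep_a (hq0 : q ≠ 0) : rep q hq0 (a K q) = aEnd q := by
  simp [a, rep_mk]

lemma rep_b (hq0 : q ≠ 0) : rep q hq0 (b K q) = bEnd := by
  simp [b, rep_mk]

/-- `Carrier K` as a module over the quantum plane. -/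
abbrev carrierModule (hq0 : q ≠ 0) : Module (QuantumPlane K q) (Carrier K) :=
  Module.compHom _ (rep q hq0).toRingHom

/-- A subspace of `Carrier K` stable under the actions of `a` and `b` is stable under the
action of the quantum plane. -/
lemma rep_apply_mem (hq0 : q ≠ 0) (P : Submodule K (Carrier K))
    (ha : ∀ v ∈ P, aEnd q v ∈ P) (hb : ∀ v ∈ P, bEnd v ∈ P) (x : QuantumPlane K q) :
    ∀ v ∈ P, rep q hq0 x v ∈ P := by
  obtain ⟨y, rfl⟩ := RingQuot.mkAlgHom_surjective K _ x
  rw [rep_mk]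
  induction y using FreeAlgebra.induction with
  | grade0 r => intro v hv; simpa [Module.algebraMap_end_apply] using P.smul_mem r hv
  | grade1 i => fin_cases i <;> simpa
  | mul y z hy hz => intro v hv; simpa using hy _ (hz v hv)
  | add y z hy hz => intro v hv; simpa using P.add_mem (hy v hv) (hz v hv)

lemma zpow_injective_of_pow_ne_one {q : K} (hq0 : q ≠ 0) (hq : ∀ k : ℕ, 0 < k → q ^ k ≠ 1) :
    Function.Injective fun i : ℤ => q ^ i := by
  have key : ∀ i j : ℤ, i < j → q ^ i ≠ q ^ j := fun i j hij h => by
    refine hq (j - i).toNat (by omega) ?_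
    rw [← zpow_natCast, Int.toNat_of_nonneg (by omega), zpow_sub₀ hq0, h,
      div_self (zpow_ne_zero _ hq0)]
  intro i j h
  rcases lt_trichotomy i j with hij | hij | hij
  · exact absurd h (key _ _ hij)
  · exact hij
  · exact absurd h.symm (key _ _ hij)

/-- A stable subspace containing some `e i` contains all of them. -/
lemma single_inl_mem {q : K} {P : Submodule K (Carrier K)}
    (ha : ∀ v ∈ P, aEnd q v ∈ P) (hb : ∀ v ∈ P, bEnd v ∈ P)
    (hq0 : q ≠ 0) {i : ℤ} (h : single (Sum.inl i) (1 : K) ∈ P) (j : ℤ) :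
    single (Sum.inl j) (1 : K) ∈ P := by
  induction j using Int.inductionOn' (b := i) with
  | zero => exact h
  | succ k _ hk => simpa [bEnd_inl] using hb _ hk
  | pred k _ hk =>
    have := P.smul_mem (q ^ k)⁻¹ (ha _ hk)
    rwa [aEnd_inl, smul_single, smul_eq_mul, one_mul, inv_mul_cancel₀ (zpow_ne_zero _ hq0)] at this

/-- A stable subspace containing a nonzero combination of the `e i` contains `e 0`. -/
lemma single_zero_mem_of_inr_eq_zero {q : K} {P : Submodule K (Carrier K)}
    (ha : ∀ v ∈ P, aEnd q v ∈ P) (hb : ∀ v ∈ P, bEnd v ∈ P)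
    (hq0 : q ≠ 0) (hq : ∀ k : ℕ, 0 < k → q ^ k ≠ 1)
    (v : Carrier K) (hv : v ∈ P) (hv0 : v ≠ 0) (hr : ∀ n, v (Sum.inr n) = 0) :
    single (Sum.inl 0) (1 : K) ∈ P := by
  induction h : v.support.card using Nat.strong_induction_on generalizing v with
  | _ m ih =>
  subst h
  obtain ⟨x, hx⟩ := Finsupp.support_nonempty_iff.2 hv0
  obtain ⟨j, rfl⟩ : ∃ j, x = Sum.inl j := by
    rcases x with j | n
    · exact ⟨j, rfl⟩
    · exact absurd (hr n) (by simpa using hx)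
  set w := bEnd (aEnd q v) - q ^ j • v with hw
  have hwP : w ∈ P := P.sub_mem (hb _ (ha _ hv)) (P.smul_mem _ hv)
  have hwl (i : ℤ) : w (Sum.inl i) = (q ^ i - q ^ j) * v (Sum.inl i) := by
    simp [hw, bEnd_apply_inl, aEnd_apply_inl, hr, sub_mul]
  have hwr (n : ℕ) : w (Sum.inr n) = 0 := by
    rcases n with _ | n <;>
      simp [hw, bEnd_apply_inr_zero, bEnd_apply_inr_succ, aEnd_apply_inr, hr]
  by_cases hw0 : w = 0
  · have hvj : v = single (Sum.inl j) (v (Sum.inl j)) := by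
      ext y
      rcases y with i | n
      · by_cases hij : j = i
        · simp [hij]
        · have h1 := hwl i
          rw [hw0, coe_zero, Pi.zero_apply, eq_comm, mul_eq_zero, sub_eq_zero] at h1
          have h2 := h1.resolve_left fun e => hij (zpow_injective_of_pow_ne_one hq0 hq e).symm
          simp [hij, h2]
      · simp [hr]
    have hj : v (Sum.inl j) ≠ 0 := by simpa using hx
    have := P.smul_mem (v (Sum.inl j))⁻¹ hv
    rw [hvj] at this
    exact single_inl_mem ha hb hq0 (i := j) (by simpa [hj] using this) 0
  · refine ih _ (Finset.card_lt_card ?_) w hwP hw0 hwr rfl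
    refine (Finset.ssubset_iff_of_subset ?_).2 ⟨Sum.inl j, hx, by simp [hwl]⟩
    intro y hy
    rcases y with i | n
    · rw [mem_support_iff, hwl] at hy
      exact mem_support_iff.2 (right_ne_zero_of_mul hy)
    · simp [hwr] at hy

/-- The operator `a - q ^ n` does not kill vectors with nonzero `f n` coordinate. -/
lemma aEnd_sub_smul_ne_zero {q : K} (hq0 : q ≠ 0) (hq : ∀ k : ℕ, 0 < k → q ^ k ≠ 1)
    (v : Carrier K) (n : ℕ) (hn : v (Sum.inr n) ≠ 0) : aEnd q v - q ^ n • v ≠ 0 := by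
  intro hw
  have hl (j : ℤ) (hj : j ≠ n) :
      q ^ (j + 1) * v (Sum.inl (j + 1)) = q ^ n * v (Sum.inl j) := by
    have h1 := DFunLike.congr_fun hw (Sum.inl j)
    have h2 : (if 0 ≤ j then v (Sum.inr j.toNat) else 0) = 0 := by
      split_ifs with h0
      · have h3 := DFunLike.congr_fun hw (Sum.inr j.toNat)
        simp only [coe_sub, coe_smul, Pi.sub_apply, Pi.smul_apply, aEnd_apply_inr, smul_eq_mul,
          coe_zero, Pi.zero_apply, ← sub_mul, mul_eq_zero, sub_eq_zero] at h3
        refine h3.resolve_left fun e => hj ?_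
        refine zpow_injective_of_pow_ne_one hq0 hq ?_
        rw [← zpow_natCast, Int.toNat_of_nonneg h0] at e
        simpa using e
      · rfl
    simpa [aEnd_apply_inl, h2, sub_eq_zero] using h1
  have hnn : q ^ ((n : ℤ) + 1) * v (Sum.inl (n + 1)) + q ^ n * v (Sum.inr n)
      = q ^ n * v (Sum.inl n) := by
    have h1 := DFunLike.congr_fun hw (Sum.inl (n : ℤ))
    simpa [aEnd_apply_inl, sub_eq_zero] using h1
  let T : Finset ℤ := v.support.preimage Sum.inl Sum.inl_injective.injOn
  have hT (j : ℤ) : j ∈ T ↔ v (Sum.inl j) ≠ 0 := by simp [T]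
  have hTne : T.Nonempty := by
    by_contra hne
    have h0 (j : ℤ) : v (Sum.inl j) = 0 := by
      by_contra hj
      exact hne ⟨j, (hT j).2 hj⟩
    simp [h0, hq0, hn] at hnn
  have hmin : T.min' hTne - 1 = n := by
    by_contra hne
    have h1 := hl _ hne
    have h2 : v (Sum.inl (T.min' hTne - 1)) = 0 := by
      by_contra h3
      have := T.min'_le _ ((hT _).2 h3)
      omega
    rw [h2, sub_add_cancel, mul_zero] at h1
    exact mul_ne_zero (zpow_ne_zero _ hq0) ((hT _).1 (T.min'_mem hTne)) h1
  have hmax : T.max' hTne = n := by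
    by_contra hne
    have h1 := hl _ hne
    have h2 : v (Sum.inl (T.max' hTne + 1)) = 0 := by
      by_contra h3
      have := T.le_max' _ ((hT _).2 h3)
      omega
    rw [h2, mul_zero] at h1
    exact mul_ne_zero (pow_ne_zero _ hq0) ((hT _).1 (T.max'_mem hTne)) h1.symm
  have := T.min'_le _ (T.max'_mem hTne)
  omega

/-- Every nonzero stable subspace contains `e 0`. -/
lemma single_zero_mem {q : K} {P : Submodule K (Carrier K)}
    (ha : ∀ v ∈ P, aEnd q v ∈ P) (hb : ∀ v ∈ P, bEnd v ∈ P)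
    (hq0 : q ≠ 0) (hq : ∀ k : ℕ, 0 < k → q ^ k ≠ 1)
    (v : Carrier K) (hv : v ∈ P) (hv0 : v ≠ 0) : single (Sum.inl 0) (1 : K) ∈ P := by
  induction h : (v.support.filter fun x => x.isRight = true).card
    using Nat.strong_induction_on generalizing v with
  | _ m ih =>
  subst h
  by_cases hr : ∀ n, v (Sum.inr n) = 0
  · exact single_zero_mem_of_inr_eq_zero ha hb hq0 hq v hv hv0 hr
  · push Not at hr
    obtain ⟨n, hn⟩ := hr
    have hw0 := aEnd_sub_smul_ne_zero hq0 hq v n hn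
    have hwr (i : ℕ) :
        (aEnd q v - q ^ n • v) (Sum.inr i) = (q ^ i - q ^ n) * v (Sum.inr i) := by
      simp [aEnd_apply_inr, sub_mul]
    refine ih _ (Finset.card_lt_card ?_) _ (P.sub_mem (ha _ hv) (P.smul_mem _ hv)) hw0 rfl
    refine (Finset.ssubset_iff_of_subset ?_).2 ⟨Sum.inr n, by simp [hn], by simp [aEnd_apply_inr]⟩
    intro y hy
    rcases y with i | i
    · simp at hy
    · rw [Finset.mem_filter, mem_support_iff, hwr] at hy
      exact Finset.mem_filter.2 ⟨mem_support_iff.2 (right_ne_zero_of_mul hy.1), rfl⟩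

/-- A stable subspace containing `f 0` is everything. -/
lemma eq_top_of_single_inr_zero_mem {q : K} {P : Submodule K (Carrier K)}
    (ha : ∀ v ∈ P, aEnd q v ∈ P) (hb : ∀ v ∈ P, bEnd v ∈ P)
    (hq0 : q ≠ 0) (h : single (Sum.inr 0) (1 : K) ∈ P) :
    P = ⊤ := by
  have hf (n : ℕ) : single (Sum.inr n) (1 : K) ∈ P := by
    induction n with
    | zero => exact h
    | succ n hn => simpa [bEnd_inr] using hb _ hn
  have he : single (Sum.inl 0) (1 : K) ∈ P := by
    simpa [aEnd_inr] using P.sub_mem (ha _ h) h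
  refine eq_top_iff.2 fun v _ => ?_
  induction v using Finsupp.induction_linear with
  | zero => exact P.zero_mem
  | add f g hf hg => exact P.add_mem (hf trivial) (hg trivial)
  | single x c =>
    rcases x with i | n
    · simpa using P.smul_mem c (single_inl_mem ha hb hq0 he i)
    · simpa using P.smul_mem c (hf n)

/-- The subspace of vectors whose `f i` coordinates vanish for `i < n`. -/
def tail (K : Type) [Field K] (n : ℕ) : Submodule K (Carrier K) where
  carrier := {v | ∀ i < n, v (Sum.inr i) = 0}
  zero_mem' := by simp
  add_mem' hv hw i hi := by simp [hv i hi, hw i hi]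
  smul_mem' c v hv i hi := by simp [hv i hi]

lemma aEnd_mem_tail {n : ℕ} : ∀ v ∈ tail K n, aEnd q v ∈ tail K n := fun v hv i hi => by
  rw [aEnd_apply_inr, hv i hi, mul_zero]

lemma bEnd_mem_tail {n : ℕ} : ∀ v ∈ tail K n, bEnd v ∈ tail K n := fun v hv i hi => by
  rcases i with _ | i
  · exact bEnd_apply_inr_zero v
  · rw [bEnd_apply_inr_succ, hv i (by omega)]

/-- The submodule over the quantum plane underlying `tail`. -/
def tailSubmodule (hq0 : q ≠ 0) (n : ℕ) :
    letI := carrierModule q hq0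
    Submodule (QuantumPlane K q) (Carrier K) :=
  letI := carrierModule q hq0
  { (tail K n).toAddSubmonoid with
    smul_mem' := fun x v hv =>
      rep_apply_mem q hq0 _ (aEnd_mem_tail q) bEnd_mem_tail x v hv }

lemma not_isArtinian (hq0 : q ≠ 0) :
    letI := carrierModule q hq0
    ¬ IsArtinian (QuantumPlane K q) (Carrier K) := by
  let := carrierModule q hq0
  intro hA
  obtain ⟨n, hn⟩ := IsArtinian.monotone_stabilizes
    (⟨fun n => OrderDual.toDual (tailSubmodule q hq0 n), fun m n hmn v hv i hi =>
      hv i (hi.trans_le hmn)⟩ : ℕ →o (Submodule (QuantumPlane K q) (Carrier K))ᵒᵈ)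
  have h1 : tailSubmodule q hq0 n = tailSubmodule q hq0 (n + 1) := hn (n + 1) n.le_succ
  have h2 : single (Sum.inr n) (1 : K) ∈ tailSubmodule q hq0 n := fun i hi => by
    simp [hi.ne']
  rw [h1] at h2
  simpa using h2 n n.lt_succ_self

/-- A submodule over the quantum plane, viewed as a subspace. -/
def toSubspace (hq0 : q ≠ 0) :
    letI := carrierModule q hq0
    Submodule (QuantumPlane K q) (Carrier K) → Submodule K (Carrier K) :=
  letI := carrierModule q hq0
  fun N =>
  { N.toAddSubmonoid with
    smul_mem' := fun c v hv => by
      have h : rep q hq0 (algebraMap K _ c) v ∈ N := N.smul_mem (algebraMap K _ c) hv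
      rwa [AlgHom.commutes, Module.algebraMap_end_apply] at h }

lemma aEnd_mem_toSubspace (hq0 : q ≠ 0) :
    letI := carrierModule q hq0
    ∀ N : Submodule (QuantumPlane K q) (Carrier K), ∀ v ∈ toSubspace q hq0 N,
      aEnd q v ∈ toSubspace q hq0 N := by
  let := carrierModule q hq0
  intro N v hv
  rw [← rep_a q hq0]
  exact N.smul_mem (a K q) hv

lemma bEnd_mem_toSubspace (hq0 : q ≠ 0) :
    letI := carrierModule q hq0
    ∀ N : Submodule (QuantumPlane K q) (Carrier K), ∀ v ∈ toSubspace q hq0 N,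
      bEnd v ∈ toSubspace q hq0 N := by
  let := carrierModule q hq0
  intro N v hv
  rw [← rep_b q hq0]
  exact N.smul_mem (b K q) hv

end QuantumPlane

/-- If `q` is not a root of unity, the quantum plane `B(q)` does not satisfy property
`(⋄)`: there is a cyclic (hence finitely generated) monolithic left `B(q)`-module that
is not Artinian. -/
theorem quantumPlane_not_diamond (K : Type) [Field K] (q : K) (hq0 : q ≠ 0)
    (hq : ∀ k : ℕ, 0 < k → q ^ k ≠ 1) :
    Nonempty (CyclicMonolithicNonArtinianModule (QuantumPlane K q)) := by
  let := QuantumPlane.carrierModule q hq0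
  let e : QuantumPlane.Carrier K := Finsupp.single (Sum.inl 0) 1
  let f : QuantumPlane.Carrier K := Finsupp.single (Sum.inr 0) 1
  have he : e ≠ 0 := by simp [e]
  have key (N : Submodule (QuantumPlane K q) (QuantumPlane.Carrier K)) (hN : N ≠ ⊥) : e ∈ N := by
    obtain ⟨v, hv, hv0⟩ := N.exists_mem_ne_zero_of_ne_bot hN
    exact QuantumPlane.single_zero_mem (P := QuantumPlane.toSubspace q hq0 N)
      (QuantumPlane.aEnd_mem_toSubspace q hq0 N) (QuantumPlane.bEnd_mem_toSubspace q hq0 N)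
      hq0 hq v hv hv0
  have hspan : e ∈ Submodule.span (QuantumPlane K q) {e} := Submodule.mem_span_singleton_self e
  refine ⟨{
    M := QuantumPlane.Carrier K
    cyclic := ⟨f, ?_⟩
    monolith := Submodule.span _ {e}
    monolith_simple := isSimpleModule_iff_isAtom.2 ⟨?_, fun N hN => ?_⟩
    monolith_essential := fun N hN h => he ?_
    not_artinian := QuantumPlane.not_isArtinian q hq0 }⟩
  · have h := QuantumPlane.eq_top_of_single_inr_zero_mem
      (QuantumPlane.aEnd_mem_toSubspace q hq0 (Submodule.span _ {f}))
      (QuantumPlane.bEnd_mem_toSubspace q hq0 (Submodule.span _ {f})) hq0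
      (Submodule.mem_span_singleton_self f)
    refine eq_top_iff.2 fun v _ => ?_
    have hv : v ∈ QuantumPlane.toSubspace q hq0 (Submodule.span _ {f}) := h ▸ Submodule.mem_top
    exact hv
  · exact fun h => he (Submodule.span_singleton_eq_bot.1 h)
  · by_contra hne
    exact hN.not_ge ((Submodule.span_singleton_le_iff_mem _ _).2 (key N hne))
  · have hmem : e ∈ N ⊓ Submodule.span (QuantumPlane K q) {e} := ⟨key N hN, hspan⟩
    rw [h] at hmem
    exact (Submodule.mem_bot _).1 hmem

end
end

section
/- Let K be a field, let r ∈ K be a primitive n-th root of unity, and let α = 2r, β = −r², γ ∈ K, so that X² − αX − β = (X − r)². Then every finitely generated essential extension of a simple module over the down-up algebra A(α, β, γ) is Artinian; equivalently, every finitely generated monolithic A(α, β, γ)-module is Artinian. -/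
noncomputable section

open FreeAlgebra

/-- Defining relations of the down-up algebra `A(α, β, γ)`: the generator `ι K 0`
plays the role of `d` and `ι K 1` plays the role of `u`. -/
inductive DownUpRel (K : Type) [Field K] (α β γ : K) :
    FreeAlgebra K (Fin 2) → FreeAlgebra K (Fin 2) → Prop
  | rel1 : DownUpRel K α β γ
      (ι K (0 : Fin 2) * ι K (0 : Fin 2) * ι K (1 : Fin 2))
      (α • (ι K (0 : Fin 2) * ι K (1 : Fin 2) * ι K (0 : Fin 2)) +
        β • (ι K (1 : Fin 2) * ι K (0 : Fin 2) * ι K (0 : Fin 2)) +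
        γ • ι K (0 : Fin 2))
  | rel2 : DownUpRel K α β γ
      (ι K (0 : Fin 2) * ι K (1 : Fin 2) * ι K (1 : Fin 2))
      (α • (ι K (1 : Fin 2) * ι K (0 : Fin 2) * ι K (1 : Fin 2)) +
        β • (ι K (1 : Fin 2) * ι K (1 : Fin 2) * ι K (0 : Fin 2)) +
        γ • ι K (1 : Fin 2))

/-- The down-up algebra `A(α, β, γ)`. -/
abbrev DownUpAlgebra (K : Type) [Field K] (α β γ : K) : Type :=
  RingQuot (DownUpRel K α β γ)

/-- The generator `d` of the down-up algebra. -/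
def DownUpAlgebra.d (K : Type) [Field K] (α β γ : K) : DownUpAlgebra K α β γ :=
  RingQuot.mkAlgHom K (DownUpRel K α β γ) (ι K (0 : Fin 2))

/-- The generator `u` of the down-up algebra. -/
def DownUpAlgebra.u (K : Type) [Field K] (α β γ : K) : DownUpAlgebra K α β γ :=
  RingQuot.mkAlgHom K (DownUpRel K α β γ) (ι K (1 : Fin 2))

namespace LeadingTerm

open Polynomial

/-- The position of an exponent pair in the degree-lexicographic enumeration of `ℕ × ℕ`. -/
def rank (q : ℕ × ℕ) : ℕ := ∑ i ∈ Finset.range (q.1 + q.2 + 1), i + q.1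

lemma rank_lt_of_degree_lt {p q : ℕ × ℕ} (h : p.1 + p.2 < q.1 + q.2) : rank p < rank q := by
  have h1 : ∑ i ∈ Finset.range (p.1 + p.2 + 2), i ≤ ∑ i ∈ Finset.range (q.1 + q.2 + 1), i :=
    Finset.sum_le_sum_of_subset (by simpa using h)
  rw [Finset.sum_range_succ] at h1
  unfold rank
  omega

lemma rank_lt_iff {p q : ℕ × ℕ} : rank p < rank q ↔
    p.1 + p.2 < q.1 + q.2 ∨ (p.1 + p.2 = q.1 + q.2 ∧ p.1 < q.1) := by
  rcases lt_trichotomy (p.1 + p.2) (q.1 + q.2) with h | h | h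
  · simp [rank_lt_of_degree_lt h, h]
  · simp [rank, h]
  · have := rank_lt_of_degree_lt h
    constructor
    · intro h'; omega
    · rintro (h' | h') <;> omega

lemma rank_injective : Function.Injective rank := by
  intro p q h
  have h1 := mt rank_lt_iff.2 (not_lt.2 h.ge)
  have h2 := mt rank_lt_iff.2 (not_lt.2 h.le)
  apply Prod.ext <;> omega

lemma rank_add_lt {p q : ℕ × ℕ} (h : p.1 + p.2 < q.1 + q.2 ∨
    (p.1 + p.2 = q.1 + q.2 ∧ p.1 < q.1)) (a : ℕ × ℕ) : rank (a + p) < rank (a + q) := by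
  rw [rank_lt_iff]
  simp only [Prod.fst_add, Prod.snd_add]
  omega

@[simp] lemma rank_zero : rank 0 = 0 := by simp [rank]

lemma degree_le_rank (q : ℕ × ℕ) : q.1 + q.2 ≤ rank q := by
  unfold rank
  rw [Finset.sum_range_succ]
  omega

lemma finite_rank_lt (k : ℕ) : {q : ℕ × ℕ | rank q < k}.Finite :=
  ((Set.finite_lt_nat k).preimage rank_injective.injOn)

/-- An ascending sequence of monotone families of elements of a Noetherian order, indexed by
the pairs whose degree is divisible by `e`, is eventually constant. -/
lemma eventually_const_of_monotone_family {α : Type*} [PartialOrder α] [WellFoundedGT α] (e : ℕ)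
    (g : ℕ → ℕ × ℕ → α) (hg : Monotone g)
    (hq : ∀ p q, e ∣ p.1 + p.2 → e ∣ q.1 + q.2 → p ≤ q → ∀ i, g i p ≤ g i q) :
    ∃ N, ∀ i, N ≤ i → ∀ q, e ∣ q.1 + q.2 → g N q = g i q := by
  by_contra! hcon
  choose next hnext pos hpos hne using hcon
  let N : ℕ → ℕ := fun k => Nat.rec 0 (fun _ n => next n) k
  have hNs : ∀ k, N (k + 1) = next (N k) := fun k => rfl
  have hNm : Monotone N := monotone_nat_of_le_succ fun k => by rw [hNs]; exact hnext _
  obtain ⟨s, hs⟩ := (wellQuasiOrdered_le (α := ℕ × ℕ)).exists_monotone_subseq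
    (fun k => pos (N k))
  have hlt : ∀ k, g (N (s k)) (pos (N (s k))) < g (N (s (k + 1))) (pos (N (s (k + 1)))) := by
    intro k
    have h1 : g (N (s k)) (pos (N (s k))) < g (N (s k + 1)) (pos (N (s k))) :=
      lt_of_le_of_ne (hg (hNm (Nat.le_succ _)) _) (by rw [hNs]; exact hne _)
    have h2 : N (s k + 1) ≤ N (s (k + 1)) := hNm (s.strictMono (Nat.lt_succ_self k))
    exact h1.trans_le ((hg h2 _).trans (hq _ _ (hpos _) (hpos _) (hs _ _ (Nat.le_succ k)) _))
  exact (RelEmbedding.natGT (r := fun a b : α => a > b) _ hlt).not_wellFounded (wellFounded_gt)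

end LeadingTerm

namespace LeadingTerm

open Polynomial

variable {K A : Type} [Field K] [Ring A] [Algebra K A]

/-- The elements of `A` that are combinations, with right coefficients polynomials in `h`, of
the `m q` with `q` of rank less than `k` and of degree divisible by `e`. -/
def low (h : A) (e : ℕ) (m : ℕ × ℕ → A) (k : ℕ) : Submodule K A :=
  Submodule.span K {a | ∃ q : ℕ × ℕ, ∃ s : K[X], e ∣ q.1 + q.2 ∧ rank q < k ∧
    a = m q * aeval h s}

/-- `A` is spanned by the products `m q * s`, with `s` a polynomial in `h` and `q` an exponent
pair of degree divisible by `e`; moreover `m` is multiplicative up to a nonzero scalar and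
terms of lower degree, and `h` is normalized by every `m q`. -/
structure IsSpanning (K : Type) [Field K] [Algebra K A] (h : A) (e : ℕ) (m : ℕ × ℕ → A) :
    Prop where
  one : m 0 = 1
  left : ∀ (s : K[X]) q, ∃ s' : K[X], aeval h s * m q = m q * aeval h s'
  right : ∀ (s : K[X]) q, ∃ s' : K[X], m q * aeval h s = aeval h s' * m q
  mul : ∀ p q : ℕ × ℕ, e ∣ p.1 + p.2 → e ∣ q.1 + q.2 → ∃ c : K, c ≠ 0 ∧
    m p * m q - c • m (p + q) ∈ low (K := K) h e m (rank (p + q))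
  span : ∀ a : A, ∃ k, a ∈ low (K := K) h e m k

variable {h : A} {e : ℕ} {m : ℕ × ℕ → A}

lemma low_mono {k l : ℕ} (hkl : k ≤ l) : low (K := K) h e m k ≤ low h e m l :=
  Submodule.span_mono fun _ ⟨q, s, he, hr, ha⟩ => ⟨q, s, he, hr.trans_le hkl, ha⟩

lemma mul_aeval_mem_low {q : ℕ × ℕ} (he : e ∣ q.1 + q.2) {k : ℕ} (hk : rank q < k) (s : K[X]) :
    m q * aeval h s ∈ low (K := K) h e m k :=
  Submodule.subset_span ⟨q, s, he, hk, rfl⟩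

lemma low_zero : low (K := K) h e m 0 = ⊥ := by
  rw [low, Submodule.span_eq_bot]
  rintro a ⟨q, s, -, hr, -⟩
  exact absurd hr (Nat.not_lt_zero _)

lemma low_induction {k : ℕ} {W : Submodule K A} {f : A →ₗ[K] A}
    (hf : ∀ q : ℕ × ℕ, ∀ s : K[X], e ∣ q.1 + q.2 → rank q < k → f (m q * aeval h s) ∈ W)
    {a : A} (ha : a ∈ low (K := K) h e m k) : f a ∈ W := by
  have : low (K := K) h e m k ≤ W.comap f := by
    rw [low, Submodule.span_le]
    rintro _ ⟨q, s, he, hr, rfl⟩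
    exact hf q s he hr
  exact this ha

/-- An element of `low (k + 1)` has a leading term in position `k`, or lies in `low k`. -/
lemma mem_low_succ {k : ℕ} {a : A} (ha : a ∈ low (K := K) h e m (k + 1)) :
    a ∈ low (K := K) h e m k ∨ ∃ q : ℕ × ℕ, ∃ s : K[X], e ∣ q.1 + q.2 ∧ rank q = k ∧
      a - m q * aeval h s ∈ low (K := K) h e m k := by
  refine Submodule.span_induction (p := fun a _ => a ∈ low (K := K) h e m k ∨
    ∃ q : ℕ × ℕ, ∃ s : K[X], e ∣ q.1 + q.2 ∧ rank q = k ∧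
      a - m q * aeval h s ∈ low (K := K) h e m k) ?_ ?_ ?_ ?_ ha
  · rintro _ ⟨q, s, he, hr, rfl⟩
    rcases Nat.lt_succ_iff_lt_or_eq.1 hr with hr | hr
    · exact Or.inl (mul_aeval_mem_low he hr s)
    · exact Or.inr ⟨q, s, he, hr, by simp⟩
  · exact Or.inl (zero_mem _)
  · rintro x y - - (hx | ⟨q, s, he, hr, hx⟩) (hy | ⟨q', s', he', hr', hy⟩)
    · exact Or.inl (add_mem hx hy)
    · refine Or.inr ⟨q', s', he', hr', ?_⟩
      rw [add_sub_assoc]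
      exact add_mem hx hy
    · refine Or.inr ⟨q, s, he, hr, ?_⟩
      rw [add_sub_right_comm]
      exact add_mem hx hy
    · obtain rfl := rank_injective (hr.trans hr'.symm)
      refine Or.inr ⟨q, s + s', he, hr, ?_⟩
      rw [map_add, mul_add, add_sub_add_comm]
      exact add_mem hx hy
  · rintro c x - (hx | ⟨q, s, he, hr, hx⟩)
    · exact Or.inl (Submodule.smul_mem _ _ hx)
    · refine Or.inr ⟨q, c • s, he, hr, ?_⟩
      rw [map_smul, mul_smul_comm, ← smul_sub]
      exact Submodule.smul_mem _ _ hx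

lemma low_mul_aeval {k : ℕ} {a : A} (ha : a ∈ low (K := K) h e m k) (s : K[X]) :
    a * aeval h s ∈ low (K := K) h e m k := by
  refine low_induction (f := LinearMap.mulRight K (aeval h s)) ?_ ha
  intro q s' he hr
  rw [LinearMap.mulRight_apply, mul_assoc, ← map_mul]
  exact mul_aeval_mem_low he hr _

namespace IsSpanning

variable (H : IsSpanning K h e m)
include H

lemma aeval_mul_low {k : ℕ} {a : A} (ha : a ∈ low (K := K) h e m k) (s : K[X]) :
    aeval h s * a ∈ low (K := K) h e m k := by
  refine low_induction (f := LinearMap.mulLeft K (aeval h s)) ?_ ha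
  intro q s' he hr
  obtain ⟨s'', hs⟩ := H.left s q
  rw [LinearMap.mulLeft_apply, ← mul_assoc, hs, mul_assoc, ← map_mul]
  exact mul_aeval_mem_low he hr _

lemma aeval_mem_low {k : ℕ} (hk : 0 < k) (s : K[X]) : aeval h s ∈ low (K := K) h e m k := by
  have := mul_aeval_mem_low (K := K) (h := h) (m := m) (q := 0) (e := e) (by simp)
    (by simpa using hk) s
  rwa [H.one, one_mul] at this

lemma mul_mem_low {p q : ℕ × ℕ} (hp : e ∣ p.1 + p.2) (hq : e ∣ q.1 + q.2) {k : ℕ}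
    (hk : rank (p + q) < k) : m p * m q ∈ low (K := K) h e m k := by
  obtain ⟨c, -, hc⟩ := H.mul p q hp hq
  have h1 : m (p + q) * aeval h (C c) ∈ low (K := K) h e m k :=
    mul_aeval_mem_low (by
      simp only [Prod.fst_add, Prod.snd_add]
      rw [add_add_add_comm]
      exact dvd_add hp hq) hk _
  rw [aeval_C, ← Algebra.commutes, ← Algebra.smul_def] at h1
  simpa using add_mem (low_mono hk.le hc) h1

lemma mul_low {p q : ℕ × ℕ} (hp : e ∣ p.1 + p.2) {a : A}
    (ha : a ∈ low (K := K) h e m (rank q)) : m p * a ∈ low (K := K) h e m (rank (p + q)) := by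
  refine low_induction (f := LinearMap.mulLeft K (m p)) ?_ ha
  intro q' s he hr
  rw [LinearMap.mulLeft_apply, ← mul_assoc]
  exact low_mul_aeval (H.mul_mem_low hp he (rank_add_lt (rank_lt_iff.1 hr) p)) s

lemma low_mul {p q : ℕ × ℕ} (hq : e ∣ q.1 + q.2) {a : A}
    (ha : a ∈ low (K := K) h e m (rank p)) : a * m q ∈ low (K := K) h e m (rank (p + q)) := by
  refine low_induction (f := LinearMap.mulRight K (m q)) ?_ ha
  intro p' s he hr
  obtain ⟨s', hs⟩ := H.left s q
  rw [LinearMap.mulRight_apply, mul_assoc, hs, ← mul_assoc]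
  refine low_mul_aeval (H.mul_mem_low he hq ?_) s'
  rw [add_comm p', add_comm p]
  exact rank_add_lt (rank_lt_iff.1 hr) q

/-- The ideal of leading coefficients in position `q` of the elements of a left ideal. -/
def lead (I : Ideal A) (q : ℕ × ℕ) : Ideal K[X] where
  carrier := {s | ∃ a ∈ low (K := K) h e m (rank q), m q * aeval h s + a ∈ I}
  zero_mem' := ⟨0, zero_mem _, by simp⟩
  add_mem' := by
    rintro s t ⟨a, ha, hs⟩ ⟨b, hb, ht⟩
    refine ⟨a + b, add_mem ha hb, ?_⟩
    rw [map_add, mul_add, add_add_add_comm]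
    exact add_mem hs ht
  smul_mem' := by
    rintro c s ⟨a, ha, hs⟩
    obtain ⟨c', hc⟩ := H.right c q
    refine ⟨aeval h c' * a, H.aeval_mul_low ha _, ?_⟩
    rw [smul_eq_mul, map_mul, ← mul_assoc, hc, mul_assoc, ← mul_add]
    exact I.mul_mem_left _ hs

lemma mem_lead {I : Ideal A} {q : ℕ × ℕ} {s : K[X]} : s ∈ H.lead I q ↔
    ∃ a ∈ low (K := K) h e m (rank q), m q * aeval h s + a ∈ I := Iff.rfl

lemma mem_lead_of_sub_mem {I : Ideal A} {q : ℕ × ℕ} {s : K[X]} {a : A} (ha : a ∈ I)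
    (hs : a - m q * aeval h s ∈ low (K := K) h e m (rank q)) : s ∈ H.lead I q :=
  ⟨_, hs, by simpa using ha⟩

lemma lead_mono_left {I J : Ideal A} (hIJ : I ≤ J) (q : ℕ × ℕ) : H.lead I q ≤ H.lead J q :=
  fun _ ⟨a, ha, hs⟩ => ⟨a, ha, hIJ hs⟩

lemma lead_le_add (I : Ideal A) {p q : ℕ × ℕ} (hp : e ∣ p.1 + p.2) (hq : e ∣ q.1 + q.2) :
    H.lead I q ≤ H.lead I (p + q) := by
  rintro s ⟨a, ha, hs⟩
  obtain ⟨c, hc0, hc⟩ := H.mul p q hp hq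
  have h1 : C c * s ∈ H.lead I (p + q) := by
    refine H.mem_lead_of_sub_mem (I.mul_mem_left (m p) hs) ?_
    have h2 := add_mem (low_mul_aeval hc s) (H.mul_low hp ha)
    convert h2 using 1
    rw [map_mul, aeval_C, mul_add, sub_mul, smul_mul_assoc, ← mul_assoc, ← mul_assoc,
      ← Algebra.commutes, mul_assoc (algebraMap K A c), ← Algebra.smul_def]
    abel
  have h3 := (H.lead I (p + q)).mul_mem_left (C c⁻¹) h1
  rwa [← mul_assoc, ← C_mul, inv_mul_cancel₀ hc0, C_1, one_mul] at h3

lemma lead_mono_right (I : Ideal A) {p q : ℕ × ℕ} (hp : e ∣ p.1 + p.2) (hq : e ∣ q.1 + q.2)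
    (hpq : p ≤ q) : H.lead I p ≤ H.lead I q := by
  obtain ⟨h1, h2⟩ := Prod.le_def.1 hpq
  have h3 : q = (q.1 - p.1, q.2 - p.2) + p := by
    apply Prod.ext <;> simp <;> omega
  rw [h3]
  refine H.lead_le_add I ?_ hp
  have h4 : q.1 - p.1 + (q.2 - p.2) = (q.1 + q.2) - (p.1 + p.2) := by omega
  simp only [h4]
  exact Nat.dvd_sub hq hp

/-- If the leading coefficients of `J` in all positions from `k` on are leading coefficients
of `I ≤ J`, then every element of `J` is congruent to an element of `low k` modulo `I`. -/
lemma exists_sub_mem_low {I J : Ideal A} (hIJ : I ≤ J) {k : ℕ}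
    (hk : ∀ q : ℕ × ℕ, e ∣ q.1 + q.2 → k ≤ rank q → H.lead J q ≤ H.lead I q) {a : A}
    (ha : a ∈ J) : ∃ b ∈ I, a - b ∈ low (K := K) h e m k := by
  obtain ⟨l, hl⟩ := H.span a
  induction l generalizing a with
  | zero =>
    rw [low_zero, Submodule.mem_bot] at hl
    exact ⟨0, zero_mem _, by simp [hl]⟩
  | succ l ih =>
    rcases lt_or_ge l k with hlk | hlk
    · exact ⟨0, zero_mem _, by simpa using low_mono hlk hl⟩
    rcases mem_low_succ hl with hl | ⟨q, s, he, rfl, hs⟩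
    · exact ih ha hl
    obtain ⟨b, hb, hbI⟩ := hk q he hlk (H.mem_lead_of_sub_mem ha hs)
    obtain ⟨b', hb', hb''⟩ := ih (a := a - (m q * aeval h s + b)) (sub_mem ha (hIJ hbI))
      (by rw [← sub_sub]; exact sub_mem hs hb)
    exact ⟨m q * aeval h s + b + b', add_mem hbI hb', by rwa [← sub_sub]⟩

lemma le_of_lead_le {I J : Ideal A} (hIJ : I ≤ J)
    (hk : ∀ q : ℕ × ℕ, e ∣ q.1 + q.2 → H.lead J q ≤ H.lead I q) : J ≤ I := by
  intro a ha
  obtain ⟨b, hb, hab⟩ := H.exists_sub_mem_low hIJ (k := 0) (fun q he _ => hk q he) ha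
  rw [low_zero, Submodule.mem_bot, sub_eq_zero] at hab
  exact hab ▸ hb

theorem isNoetherianRing : IsNoetherianRing A := by
  rw [isNoetherianRing_iff, ← monotone_stabilizes_iff_noetherian]
  intro f
  obtain ⟨N, hN⟩ := eventually_const_of_monotone_family e (fun i q => H.lead (f i) q)
    (fun i j hij q => H.lead_mono_left (f.monotone hij) q)
    (fun p q hp hq hpq i => H.lead_mono_right _ hp hq hpq)
  exact ⟨N, fun i hi => le_antisymm (f.monotone hi)
    (H.le_of_lead_le (f.monotone hi) fun q hq => (hN i hi q hq).ge)⟩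

end IsSpanning

end LeadingTerm

namespace LeadingTerm

open Polynomial

/-- `v` is a nonzero element lying in every nonzero submodule. -/
def InMonolith (A : Type) {M : Type} [Ring A] [AddCommGroup M] [Module A M] (v : M) : Prop :=
  v ≠ 0 ∧ ∀ x : M, x ≠ 0 → ∃ a : A, a • x = v

/-- The left ideal of elements annihilating `x`. -/
abbrev annihilatorOf (A : Type) {M : Type} [Ring A] [AddCommGroup M] [Module A M] (x : M) :
    Ideal A := LinearMap.ker (LinearMap.toSpanSingleton A M x)

lemma mem_annihilatorOf {A M : Type} [Ring A] [AddCommGroup M] [Module A M] {x : M} {a : A} :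
    a ∈ annihilatorOf A x ↔ a • x = 0 := by
  simp [annihilatorOf]

lemma commute_aeval {K A : Type} [Field K] [Ring A] [Algebra K A] {z a : A} (hz : Commute z a)
    (p : K[X]) : Commute (aeval z p) a := by
  have : aeval z p ∈ Subalgebra.centralizer K {a} := by
    refine Algebra.adjoin_le ?_ (aeval_mem_adjoin_singleton K z)
    simpa [Subalgebra.mem_centralizer_iff, Set.mem_centralizer_iff] using hz.symm.eq
  exact ((Subalgebra.mem_centralizer_iff K).1 this a rfl).symm

namespace IsSpanning

variable {K A : Type} [Field K] [Ring A] [Algebra K A] {h : A} {e : ℕ} {m : ℕ × ℕ → A}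
  (H : IsSpanning K h e m)
include H

/-- There is one nonzero polynomial `f` such that `f(X ^ n)` is a leading coefficient in every
position where some nonzero leading coefficient occurs. -/
lemma exists_expand_mem_lead (n : ℕ)
    (hnorm : ∀ s : K[X], s ≠ 0 → ∃ s' p : K[X], p ≠ 0 ∧ s * s' = expand K n p) (I : Ideal A) :
    ∃ f : K[X], f ≠ 0 ∧ ∀ q : ℕ × ℕ, e ∣ q.1 + q.2 → H.lead I q ≠ ⊥ →
      expand K n f ∈ H.lead I q := by
  by_contra! hcon
  choose! pos hdvd hbot hnot using hcon
  have hex : ∀ f : K[X], f ≠ 0 → ∃ p : K[X], p ≠ 0 ∧ expand K n p ∈ H.lead I (pos f) := by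
    intro f hf
    obtain ⟨s, hs, hs0⟩ := Submodule.exists_mem_ne_zero_of_ne_bot (hbot f hf)
    obtain ⟨s', p, hp, hsp⟩ := hnorm s hs0
    exact ⟨p, hp, hsp ▸ Ideal.mul_mem_right _ _ hs⟩
  choose! g hg0 hg using hex
  let F : ℕ → K[X] := fun k => Nat.rec 1 (fun _ f => f * g f) k
  have hFs : ∀ k, F (k + 1) = F k * g (F k) := fun k => rfl
  have hF0 : ∀ k, F k ≠ 0 := by
    intro k
    induction k with
    | zero => exact one_ne_zero
    | succ k ih => rw [hFs]; exact mul_ne_zero ih (hg0 _ ih)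
  have hFd : ∀ k l, k < l → expand K n (F l) ∈ H.lead I (pos (F k)) := by
    intro k l hkl
    induction l, hkl using Nat.le_induction with
    | base =>
      rw [Nat.succ_eq_add_one, hFs, map_mul]
      exact Ideal.mul_mem_left _ _ (hg _ (hF0 k))
    | succ l hl ih =>
      rw [hFs, map_mul]
      exact Ideal.mul_mem_right _ _ ih
  obtain ⟨k, l, hkl, hle⟩ := wellQuasiOrdered_le (fun k => pos (F k))
  exact hnot _ (hF0 l) (H.lead_mono_right I (hdvd _ (hF0 k)) (hdvd _ (hF0 l)) hle (hFd k l hkl))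

/-- A central element `h ^ n` acts algebraically on the monolith of a module. -/
theorem exists_aeval_smul_eq_zero {n : ℕ} (hn : 0 < n) (hcen : ∀ a : A, Commute (h ^ n) a)
    (hnorm : ∀ s : K[X], s ≠ 0 → ∃ s' p : K[X], p ≠ 0 ∧ s * s' = expand K n p)
    {M : Type} [AddCommGroup M] [Module A M] {v : M} (hv : InMonolith A v) :
    ∃ p : K[X], p ≠ 0 ∧ aeval (h ^ n) p • v = 0 := by
  by_contra! hcon
  have hcomm : ∀ (p : K[X]) (a : A), aeval (h ^ n) p * a = a * aeval (h ^ n) p :=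
     fun p a => (commute_aeval (hcen a) p).eq
  have hex : ∀ p : K[X], aeval (h ^ n) p = aeval h (expand K n p) := fun p =>
    (expand_aeval n p h).symm
  have hinj : ∀ s : K[X], aeval h s • v = 0 → s = 0 := by
    intro s hs
    by_contra hs0
    obtain ⟨s', p, hp, hsp⟩ := hnorm s hs0
    apply hcon p hp
    rw [hex, ← hsp, mul_comm, map_mul, mul_smul, hs, smul_zero]
  obtain ⟨f, hf0, hf⟩ := H.exists_expand_mem_lead n hnorm (annihilatorOf A v)
  have hdeg : (1 + X * f : K[X]).natDegree ≠ 0 := by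
    have h1 : (X * f : K[X]).natDegree = f.natDegree + 1 := natDegree_X_mul hf0
    rw [natDegree_add_eq_right_of_natDegree_lt (by rw [h1, natDegree_one]; omega), h1]
    omega
  have hpi0 : (1 + X * f : K[X]) ≠ 0 := fun h0 => hdeg (by rw [h0, natDegree_zero])
  obtain ⟨a, ha⟩ := hv.2 _ (hcon _ hpi0)
  rw [← mul_smul, ← hcomm, mul_smul] at ha
  have key : ∀ k, ∀ b ∈ low (K := K) h e m k, ∀ j : ℕ,
      aeval (h ^ n) (f ^ j) • a • v ≠ b • v := by
    intro k
    induction k with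
    | zero =>
      intro b hb j hj
      rw [low_zero, Submodule.mem_bot] at hb
      apply hcon (f ^ j) (pow_ne_zero _ hf0)
      rw [← ha, ← mul_smul, hcomm, mul_smul, hj, hb, zero_smul, smul_zero]
    | succ k ih =>
      intro b hb j hj
      rcases mem_low_succ hb with hb | ⟨q, s, he, rfl, hs⟩
      · exact ih b hb j hj
      have hbv : aeval h (expand K n (1 + X * f)) • b • v =
          aeval h (expand K n (f ^ j)) • v := by
        rw [← hj, ← hex, ← hex, ← mul_smul, hcomm, mul_smul, ha]
      obtain rfl | hq := eq_or_ne q 0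
      · rw [rank_zero, low_zero, Submodule.mem_bot, H.one, one_mul, sub_eq_zero] at hs
        rw [hs, ← mul_smul, ← map_mul, ← sub_eq_zero, ← sub_smul, ← map_sub] at hbv
        have h1 := sub_eq_zero.1 (hinj _ hbv)
        have hco : IsCoprime (1 + X * f : K[X]) (f ^ j) := by
          apply IsCoprime.pow_right
          exact ⟨1, -X, by ring⟩
        have h2 : IsUnit (expand K n (1 + X * f)) :=
          ((isCoprime_expand hn.ne').2 hco).isUnit_of_dvd' dvd_rfl ⟨s, h1.symm⟩
        have h3 := natDegree_eq_zero_of_isUnit h2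
        rw [natDegree_expand] at h3
        rcases Nat.mul_eq_zero.1 h3 with h4 | h4
        · exact hdeg h4
        · exact hn.ne' h4
      have hrank : 0 < rank q := by
        rw [pos_iff_ne_zero, ← rank_zero]
        exact fun hr => hq (rank_injective hr)
      obtain rfl | hs0 := eq_or_ne s 0
      · exact ih b (by simpa using hs) j hj
      have hmem : expand K n (1 + X * f) * s ∈ H.lead (annihilatorOf A v) q := by
        refine H.mem_lead_of_sub_mem (a := aeval h (expand K n (1 + X * f)) * b -
          aeval h (expand K n (f ^ j))) ?_ ?_
        · rw [mem_annihilatorOf, sub_smul, mul_smul, hbv, sub_self]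
        · have h1 := sub_mem (H.aeval_mul_low hs (expand K n (1 + X * f)))
            (H.aeval_mem_low hrank (expand K n (f ^ j)))
          convert h1 using 1
          rw [map_mul, ← mul_assoc, ← hex, ← hex, ← hcomm, mul_sub, mul_assoc]
          abel
      have hne : H.lead (annihilatorOf A v) q ≠ ⊥ := by
        intro hbot
        rw [hbot, Ideal.mem_bot] at hmem
        exact mul_ne_zero ((expand_ne_zero hn).2 hpi0) hs0 hmem
      obtain ⟨a', ha', haI⟩ := Ideal.mul_mem_right s _ (hf q he hne)
      refine ih (aeval h (expand K n f) * (b - m q * aeval h s) - a')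
        (sub_mem (H.aeval_mul_low hs _) ha') (j + 1) ?_
      rw [mem_annihilatorOf, add_smul] at haI
      rw [pow_succ, mul_comm, map_mul, mul_smul, hj, sub_smul, mul_sub, sub_smul,
        eq_neg_of_add_eq_zero_right haI, map_mul, ← mul_assoc (m q), ← hex, hcomm _ (m q * _),
        ← hcomm _ (m q), mul_assoc (aeval (h ^ n) f), mul_smul, mul_smul]
      rw [← mul_smul, ← mul_smul, hcomm _ (m q * _)]
      abel
  obtain ⟨k, hk⟩ := H.span a
  exact key k a hk 0 (by simp)

end IsSpanning
end LeadingTerm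

namespace LeadingTerm

open Polynomial
namespace IsSpanning

variable {K A : Type} [Field K] [Ring A] [Algebra K A] {h : A} {e : ℕ} {m : ℕ × ℕ → A}
  (H : IsSpanning K h e m)
include H

lemma mem_lead_zero {I : Ideal A} {s : K[X]} : s ∈ H.lead I 0 ↔ aeval h s ∈ I := by
  rw [H.mem_lead, rank_zero, low_zero, H.one]
  simp

/-- A nonzero element `y` of a module with monolith has a leading coefficient which does not
annihilate it. -/
lemma exists_mem_lead_smul_ne_zero (he : 0 < e) {N : Type} [AddCommGroup N] [Module A N] {v : N}
    (hv : InMonolith A v) {y : N} (hy : y ≠ 0) :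
    ∃ q : ℕ × ℕ, e ∣ q.1 + q.2 ∧ ∃ s ∈ H.lead (annihilatorOf A y) q, aeval h s • y ≠ 0 := by
  by_contra! hcon
  obtain ⟨a, ha⟩ := hv.2 y hy
  obtain ⟨k, hk⟩ := H.span a
  have hq'e : e ∣ (e * k, 0).1 + (e * k, 0).2 := by simp
  have hkq : k ≤ rank (e * k, 0) :=
    (Nat.le_mul_of_pos_left k he).trans ((by simp : e * k ≤ e * k + 0).trans (degree_le_rank (e * k, 0)))
  generalize (e * k, 0) = q' at hq'e hkq
  have hmy : m q' • y ≠ 0 := by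
    intro h0
    refine hy ?_
    have := hcon q' hq'e 1 ⟨0, zero_mem _, by simpa [mem_annihilatorOf] using h0⟩
    simpa using this
  obtain ⟨b, hb⟩ := hv.2 _ hmy
  obtain ⟨l, hl⟩ := H.span b
  induction l generalizing b with
  | zero =>
    rw [low_zero, Submodule.mem_bot] at hl
    rw [hl, zero_smul] at hb
    exact hv.1 hb.symm
  | succ l ih =>
    rcases mem_low_succ hl with hl | ⟨p, s, hp, rfl, hs⟩
    · exact ih b hb hl
    obtain ⟨s', hs'⟩ := H.left s q'
    obtain ⟨c, hc0, hc⟩ := H.mul p q' hp hq'e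
    have hpq : e ∣ (p + q').1 + (p + q').2 := by
      simp only [Prod.fst_add, Prod.snd_add]
      rw [add_add_add_comm]
      exact dvd_add hp hq'e
    have hle : rank q' ≤ rank (p + q') := by
      by_contra! hlt
      rw [rank_lt_iff] at hlt
      simp only [Prod.fst_add, Prod.snd_add] at hlt
      omega
    have hmem : C c * s' ∈ H.lead (annihilatorOf A y) (p + q') := by
      refine H.mem_lead_of_sub_mem (a := b * m q' - a) ?_ ?_
      · rw [mem_annihilatorOf, sub_smul, mul_smul, hb, ha, sub_self]
      · have h1 := sub_mem (add_mem (H.low_mul hq'e hs) (low_mul_aeval hc s'))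
          (low_mono (hkq.trans hle) hk)
        convert h1 using 1
        rw [sub_mul, mul_assoc (m p), hs', sub_mul, map_mul, aeval_C, ← mul_assoc, ← mul_assoc,
          ← Algebra.commutes, ← Algebra.smul_def]
        abel
    have h2 := (H.lead _ (p + q')).mul_mem_left (C c⁻¹) hmem
    rw [← mul_assoc, ← C_mul, inv_mul_cancel₀ hc0, C_1, one_mul] at h2
    refine ih (b - m p * aeval h s) ?_ hs
    rw [sub_smul, hb, mul_smul, ← mul_smul (aeval h s), hs', mul_smul (m q'), hcon _ hpq s' h2,
      smul_zero, smul_zero, sub_zero]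

/-- In a module with monolith, killed by a squarefree polynomial in `h`, the annihilator of
every element has a constant leading coefficient in some position. -/
theorem exists_lead_eq_top (he : 0 < e) {N : Type} [AddCommGroup N] [Module A N] {v : N}
    (hv : InMonolith A v) {P : K[X]} (hP : Squarefree P)
    (hPN : ∀ x : N, aeval h P • x = 0) (x : N) :
    ∃ q : ℕ × ℕ, e ∣ q.1 + q.2 ∧ H.lead (annihilatorOf A x) q = ⊤ := by
  by_contra! hcon
  let T := {q : ℕ × ℕ // e ∣ q.1 + q.2}
  have : Nonempty T := ⟨⟨0, by simp⟩⟩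
  have hdir : Directed (· ≤ ·) fun q : T => H.lead (annihilatorOf A x) q.1 := by
    intro p q
    have hpq : e ∣ (p.1 + q.1).1 + (p.1 + q.1).2 := by
      simp only [Prod.fst_add, Prod.snd_add]
      rw [add_add_add_comm]
      exact dvd_add p.2 q.2
    exact ⟨⟨p.1 + q.1, hpq⟩, H.lead_mono_right _ p.2 hpq (by simp),
      H.lead_mono_right _ q.2 hpq (by simp)⟩
  obtain ⟨p₁, hp₁⟩ := (IsPrincipalIdealRing.principal
    (⨆ q : T, H.lead (annihilatorOf A x) q.1)).principal
  have hdvd : ∀ q : ℕ × ℕ, e ∣ q.1 + q.2 → ∀ s ∈ H.lead (annihilatorOf A x) q, p₁ ∣ s := by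
    intro q hq s hs
    rw [← Ideal.mem_span_singleton, ← Ideal.submodule_span_eq, ← hp₁]
    exact Submodule.mem_iSup_of_mem (p := fun q : T => H.lead (annihilatorOf A x) q.1)
      (⟨q, hq⟩ : T) hs
  have hunit : ¬ IsUnit p₁ := by
    intro hu
    have h1 : p₁ ∈ ⨆ q : T, H.lead (annihilatorOf A x) q.1 := by
      rw [hp₁]; exact Submodule.mem_span_singleton_self _
    obtain ⟨q, hq⟩ := (Submodule.mem_iSup_of_directed _ hdir).1 h1
    exact hcon q.1 q.2 (Ideal.eq_top_of_isUnit_mem _ hq hu)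
  obtain ⟨p₂, rfl⟩ := hdvd 0 (by simp) P (H.mem_lead_zero.2 (mem_annihilatorOf.2 (hPN x)))
  have hco : IsCoprime p₁ p₂ := (squarefree_mul_iff.1 hP).1.isCoprime
  have hy : aeval h p₂ • x ≠ 0 := by
    intro h0
    have := hdvd 0 (by simp) p₂ (H.mem_lead_zero.2 (mem_annihilatorOf.2 h0))
    exact hunit (hco.isUnit_of_dvd' dvd_rfl this)
  obtain ⟨q, hq, s, ⟨a, ha, hs⟩, hne⟩ := H.exists_mem_lead_smul_ne_zero he hv hy
  have h1 : s * p₂ ∈ H.lead (annihilatorOf A x) q := by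
    refine ⟨a * aeval h p₂, low_mul_aeval ha _, ?_⟩
    rw [mem_annihilatorOf] at hs ⊢
    rw [map_mul, ← mul_assoc, ← add_mul, mul_smul, hs]
  obtain ⟨t, ht⟩ := hco.dvd_of_dvd_mul_right (hdvd q hq _ h1)
  apply hne
  rw [← mul_smul, ← map_mul, ht, mul_comm p₁ t, mul_assoc, map_mul, mul_smul, hPN, smul_zero]

end IsSpanning
end LeadingTerm

namespace LeadingTerm

open Polynomial

lemma exists_forall_eq_of_antitone {R M : Type} [Ring R] [AddCommGroup M] [Module R M]
    {I : Submodule R M} [IsArtinian R (M ⧸ I)] {J : ℕ → Submodule R M} (hJ : Antitone J)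
    (hI : ∀ i, I ≤ J i) : ∃ N, ∀ i, N ≤ i → J N = J i := by
  obtain ⟨N, hN⟩ := IsArtinian.monotone_stabilizes (R := R) (M := M ⧸ I)
    ⟨fun i => OrderDual.toDual ((J i).map I.mkQ), fun i j hij => Submodule.map_mono (hJ hij)⟩
  refine ⟨N, fun i hi => ?_⟩
  have h1 : (J N).map I.mkQ = (J i).map I.mkQ := OrderDual.toDual.injective (hN i hi)
  have h2 := congrArg (Submodule.comap I.mkQ) h1
  rwa [Submodule.comap_map_mkQ, Submodule.comap_map_mkQ, sup_eq_right.2 (hI N),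
    sup_eq_right.2 (hI i)] at h2

lemma isArtinian_quotient_of_antitone {R M : Type} [Ring R] [AddCommGroup M] [Module R M]
    {I : Submodule R M} (hI : ∀ J : ℕ → Submodule R M, Antitone J → (∀ i, I ≤ J i) →
      ∃ N, ∀ i, N ≤ i → J N = J i) : IsArtinian R (M ⧸ I) := by
  rw [← monotone_stabilizes_iff_artinian]
  intro f
  obtain ⟨N, hN⟩ := hI (fun i => (OrderDual.ofDual (f i)).comap I.mkQ)
    (fun i j hij => Submodule.comap_mono (f.monotone hij)) (fun i => by
      intro x hx
      rw [Submodule.mem_comap, Submodule.mkQ_apply, (Submodule.Quotient.mk_eq_zero I).2 hx]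
      exact zero_mem _)
  exact ⟨N, fun i hi => OrderDual.ofDual.injective
    (Submodule.comap_injective_of_surjective I.mkQ_surjective (hN i hi))⟩

lemma exists_forall_eq_of_antitone_of_mem {K : Type} [Field K] {P : K[X]} (hP : P ≠ 0)
    {J : ℕ → Ideal K[X]} (hJ : Antitone J) (hPJ : ∀ i, P ∈ J i) :
    ∃ N, ∀ i, N ≤ i → J N = J i := by
  have h1 : Module.Finite K (K[X] ⧸ Ideal.span {P}) := (AdjoinRoot.powerBasis hP).finite
  have h2 : IsArtinian K[X] (K[X] ⧸ Ideal.span {P}) := isArtinian_of_tower K inferInstance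
  exact exists_forall_eq_of_antitone (I := Ideal.span {P}) hJ fun i =>
    (Ideal.span_singleton_le_iff_mem _).2 (hPJ i)

namespace IsSpanning

variable {K A : Type} [Field K] [Ring A] [Algebra K A] {h : A} {e : ℕ} {m : ℕ × ℕ → A}

/-- Modulo a nonzero polynomial in `h`, the space `low k` is finite-dimensional. -/
lemma exists_finiteDimensional_low {P : K[X]} (hP : P ≠ 0) (k : ℕ) :
    ∃ F : Submodule K A, FiniteDimensional K F ∧
      ∀ a ∈ low (K := K) h e m k, ∃ f ∈ F, a - f ∈ Ideal.span {aeval h P} := by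
  have := (finite_rank_lt k).to_subtype
  let S : {q : ℕ × ℕ | rank q < k} → Submodule K A := fun q =>
    (degreeLT K P.natDegree).map (LinearMap.mulLeft K (m q.1) ∘ₗ (aeval h).toLinearMap)
  have hfd : FiniteDimensional K (degreeLT K P.natDegree) := by
    classical
    rw [degreeLT_eq_span_X_pow]
    exact FiniteDimensional.span_finset K _
  refine ⟨⨆ q, S q, inferInstance, fun a ha => ?_⟩
  have key : low (K := K) h e m k ≤
      (⨆ q, S q) ⊔ (Ideal.span {aeval h P} : Ideal A).restrictScalars K := by
    rw [low, Submodule.span_le]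
    rintro _ ⟨q, s, -, hq, rfl⟩
    rw [← EuclideanDomain.div_add_mod s P, map_add, mul_add, add_comm]
    refine Submodule.add_mem_sup (Submodule.mem_iSup_of_mem ⟨q, hq⟩ ⟨s % P, ?_, rfl⟩) ?_
    · rw [SetLike.mem_coe, mem_degreeLT, ← degree_eq_natDegree hP]
      exact EuclideanDomain.mod_lt s hP
    · rw [mul_comm P, map_mul, ← mul_assoc, Submodule.restrictScalars_mem]
      exact Ideal.mul_mem_left _ _ (Ideal.mem_span_singleton_self _)
  obtain ⟨f, hf, b, hb, rfl⟩ := Submodule.mem_sup.1 (key ha)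
  exact ⟨f, hf, by simpa using hb⟩

variable (H : IsSpanning K h e m)
include H

lemma mem_lead_of_aeval_mem {I : Ideal A} {P : K[X]} (hPI : aeval h P ∈ I) {q : ℕ × ℕ}
    (hq : e ∣ q.1 + q.2) : P ∈ H.lead I q :=
  H.lead_mono_right I (p := 0) (by simp) hq (by simp) (H.mem_lead_zero.2 hPI)

/-- Along a directed set of positions, the leading ideals of a descending sequence of left ideals
are eventually the same far out. -/
lemma exists_lead_le_of_directed {P : K[X]} (hP : P ≠ 0) {J : ℕ → Ideal A} (hJ : Antitone J)
    (hPJ : ∀ i, aeval h P ∈ J i) {L : Set (ℕ × ℕ)} (hL : ∀ q ∈ L, e ∣ q.1 + q.2)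
    (hne : L.Nonempty) (hdir : ∀ p ∈ L, ∀ q ∈ L, p ≤ q ∨ q ≤ p) :
    ∃ N, ∀ j, N ≤ j → ∀ i, N ≤ i → ∃ q₁ ∈ L, ∀ q ∈ L, q₁ ≤ q →
      H.lead (J j) q ≤ H.lead (J i) q := by
  have := hne.to_subtype
  obtain ⟨q₀, hq₀⟩ := hne
  obtain ⟨N, hN⟩ := exists_forall_eq_of_antitone_of_mem hP
    (J := fun i => ⨆ q : L, H.lead (J i) q.1)
    (fun i j hij => iSup_mono fun q => H.lead_mono_left (hJ hij) q.1)
    (fun i => Submodule.mem_iSup_of_mem (p := fun q : L => H.lead (J i) q.1) ⟨q₀, hq₀⟩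
      (H.mem_lead_of_aeval_mem (hPJ i) (hL q₀ hq₀)))
  refine ⟨N, fun j hj i hi => ?_⟩
  have hd : Directed (· ≤ ·) fun q : L => H.lead (J i) q.1 := by
    intro p q
    rcases hdir p.1 p.2 q.1 q.2 with hpq | hpq
    · exact ⟨q, H.lead_mono_right _ (hL _ p.2) (hL _ q.2) hpq, le_rfl⟩
    · exact ⟨p, le_rfl, H.lead_mono_right _ (hL _ q.2) (hL _ p.2) hpq⟩
  obtain ⟨g, hg⟩ := (IsPrincipalIdealRing.principal (⨆ q : L, H.lead (J i) q.1)).principal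
  have h1 : g ∈ ⨆ q : L, H.lead (J i) q.1 := by
    rw [hg]; exact Submodule.mem_span_singleton_self _
  obtain ⟨q₁, hq₁⟩ := (Submodule.mem_iSup_of_directed _ hd).1 h1
  refine ⟨q₁.1, q₁.2, fun q hq hle => ?_⟩
  have h2 : H.lead (J j) q ≤ ⨆ q : L, H.lead (J i) q.1 := by
    rw [← hN i hi, hN j hj]
    exact le_iSup (fun q : L => H.lead (J j) q.1) ⟨q, hq⟩
  refine h2.trans ?_
  rw [hg, Submodule.span_singleton_le_iff_mem]
  exact H.lead_mono_right _ (hL _ q₁.2) (hL _ hq) hle hq₁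

/-- In a descending sequence of left ideals containing a polynomial in `h` and having a constant
leading coefficient, the leading ideals eventually agree in all but finitely many positions. -/
lemma exists_forall_lead_le (he : 0 < e) {P : K[X]} (hP : P ≠ 0) {J : ℕ → Ideal A}
    (hJ : Antitone J) (hPJ : ∀ i, aeval h P ∈ J i) {q₀ : ℕ × ℕ} (hq₀ : e ∣ q₀.1 + q₀.2)
    (htop : ∀ i, H.lead (J i) q₀ = ⊤) :
    ∃ N, ∀ i, N ≤ i → ∃ k, ∀ q : ℕ × ℕ, e ∣ q.1 + q.2 → k ≤ rank q →
      H.lead (J N) q ≤ H.lead (J i) q := by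
  have hdvd : ∀ b, e ∣ (e - 1) * b + b := fun b => by
    obtain ⟨e, rfl⟩ := Nat.exists_eq_succ_of_ne_zero he.ne'
    exact ⟨b, by simp [Nat.succ_mul]⟩
  choose Nc hNc using fun b : ℕ => H.exists_lead_le_of_directed hP hJ hPJ
    (L := {q | e ∣ q.1 + q.2 ∧ q.2 = b}) (fun q hq => hq.1) ⟨((e - 1) * b, b), hdvd b, rfl⟩
    (fun p hp q hq => by
      have h1 := hp.2.trans hq.2.symm
      rcases le_total p.1 q.1 with h2 | h2
      · exact Or.inl ⟨h2, h1.le⟩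
      · exact Or.inr ⟨h2, h1.ge⟩)
  choose Nr hNr using fun a : ℕ => H.exists_lead_le_of_directed hP hJ hPJ
    (L := {q | e ∣ q.1 + q.2 ∧ q.1 = a}) (fun q hq => hq.1)
    ⟨(a, (e - 1) * a), by rw [add_comm]; exact hdvd a, rfl⟩
    (fun p hp q hq => by
      have h1 := hp.2.trans hq.2.symm
      rcases le_total p.2 q.2 with h2 | h2
      · exact Or.inl ⟨h1.le, h2⟩
      · exact Or.inr ⟨h1.ge, h2⟩)
  let N := (Finset.range q₀.2).sup Nc ⊔ (Finset.range q₀.1).sup Nr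
  have hNc' : ∀ b < q₀.2, Nc b ≤ N := fun b hb =>
    (Finset.le_sup (f := Nc) (Finset.mem_range.2 hb)).trans le_sup_left
  have hNr' : ∀ a < q₀.1, Nr a ≤ N := fun a ha =>
    (Finset.le_sup (f := Nr) (Finset.mem_range.2 ha)).trans le_sup_right
  refine ⟨N, fun i hi => ?_⟩
  have hc : ∀ b, ∃ a₁, b < q₀.2 → ∀ q : ℕ × ℕ, e ∣ q.1 + q.2 → q.2 = b → a₁ ≤ q.1 →
      H.lead (J N) q ≤ H.lead (J i) q := by
    intro b
    by_cases hb : b < q₀.2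
    · obtain ⟨q₁, hq₁, h1⟩ := hNc b N (hNc' b hb) i ((hNc' b hb).trans hi)
      exact ⟨q₁.1, fun _ q hq hqb hle => h1 q ⟨hq, hqb⟩ ⟨hle, (hq₁.2.trans hqb.symm).le⟩⟩
    · exact ⟨0, fun h => absurd h hb⟩
  have hr : ∀ a, ∃ b₁, a < q₀.1 → ∀ q : ℕ × ℕ, e ∣ q.1 + q.2 → q.1 = a → b₁ ≤ q.2 →
      H.lead (J N) q ≤ H.lead (J i) q := by
    intro a
    by_cases ha : a < q₀.1
    · obtain ⟨q₁, hq₁, h1⟩ := hNr a N (hNr' a ha) i ((hNr' a ha).trans hi)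
      exact ⟨q₁.2, fun _ q hq hqa hle => h1 q ⟨hq, hqa⟩ ⟨(hq₁.2.trans hqa.symm).le, hle⟩⟩
    · exact ⟨0, fun h => absurd h ha⟩
  choose ac hac using hc
  choose br hbr using hr
  let a₂ := (Finset.range q₀.2).sup ac
  let b₂ := (Finset.range q₀.1).sup br
  refine ⟨rank (0, q₀.1 + q₀.2 + a₂ + b₂), fun q hq hk => ?_⟩
  have hdeg : q₀.1 + q₀.2 + a₂ + b₂ ≤ q.1 + q.2 := by
    by_contra! hlt
    exact absurd (rank_lt_of_degree_lt (p := q) (q := (0, q₀.1 + q₀.2 + a₂ + b₂))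
      (by simpa using hlt)) (not_lt.2 hk)
  by_cases h1 : q.2 < q₀.2
  · have : ac q.2 ≤ a₂ := Finset.le_sup (f := ac) (Finset.mem_range.2 h1)
    exact hac q.2 h1 q hq rfl (by omega)
  by_cases h2 : q.1 < q₀.1
  · have : br q.1 ≤ b₂ := Finset.le_sup (f := br) (Finset.mem_range.2 h2)
    exact hbr q.1 h2 q hq rfl (by omega)
  have h3 := H.lead_mono_right (J i) hq₀ hq ⟨not_lt.1 h2, not_lt.1 h1⟩
  rw [htop i] at h3
  exact le_top.trans h3

/-- A cyclic module killed by a central polynomial in `h`, whose annihilator has a constant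
leading coefficient, is Artinian as soon as all `m q` of large degree kill all
finite-dimensional modules killed by the same polynomial. -/
theorem isArtinian_quotient (he : 0 < e) {P : K[X]} (hP : P ≠ 0)
    (hcen : ∀ a, Commute (aeval h P) a) {k₀ : ℕ}
    (hfd : ∀ (Q : Type) [AddCommGroup Q] [Module A Q] [Module K Q] [IsScalarTower K A Q]
      [FiniteDimensional K Q], (∀ x : Q, aeval h P • x = 0) → ∀ q : ℕ × ℕ, e ∣ q.1 + q.2 →
        k₀ ≤ q.1 + q.2 → ∀ x : Q, m q • x = 0)
    {I : Ideal A} (hPI : aeval h P ∈ I) {q₀ : ℕ × ℕ} (hq₀ : e ∣ q₀.1 + q₀.2)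
    (htop : H.lead I q₀ = ⊤) : IsArtinian A (A ⧸ I) := by
  have hnoeth := H.isNoetherianRing
  refine isArtinian_quotient_of_antitone fun (J : ℕ → Ideal A) hJ hIJ => ?_
  obtain ⟨N, hN⟩ := H.exists_forall_lead_le he hP hJ (fun i => hIJ i hPI) hq₀
    (fun i => top_le_iff.1 (htop ▸ H.lead_mono_left (hIJ i) q₀))
  have hPm : ∀ i (x : A), aeval h P * x ∈ J i := fun i x => by
    rw [(hcen x).eq]
    exact (J i).mul_mem_left x (hIJ i hPI)
  have hkill : ∀ i, N ≤ i → ∀ q : ℕ × ℕ, e ∣ q.1 + q.2 → k₀ ≤ q.1 + q.2 → ∀ x ∈ J N,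
      m q * x ∈ J i := by
    intro i hi q hq hk x hx
    obtain ⟨k, hk'⟩ := hN i hi
    obtain ⟨F, hF, hFk⟩ := exists_finiteDimensional_low (K := K) (h := h) (e := e) (m := m) hP k
    let S : Submodule A (J N) := Submodule.comap (Submodule.subtype (J N)) (J i)
    let ψ : (J N ⧸ S) →ₗ[A] A ⧸ J i := S.mapQ (J i) (J N).subtype le_rfl
    have hψ : Function.Injective ψ := by
      rw [← LinearMap.ker_eq_bot, Submodule.ker_mapQ, Submodule.mkQ_map_self]
    have hrange : ∀ y, ψ y ∈ F.map ((J i).mkQ.restrictScalars K) := by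
      intro y
      obtain ⟨y, rfl⟩ := Submodule.Quotient.mk_surjective _ y
      obtain ⟨b, hb, hyb⟩ := H.exists_sub_mem_low (hJ hi) hk' y.2
      obtain ⟨f, hf, hyf⟩ := hFk _ hyb
      refine ⟨f, hf, ?_⟩
      refine ((Submodule.Quotient.eq (J i)).2 ?_).symm
      have h1 : (y : A) - b - f ∈ J i :=
        ((Ideal.span_singleton_le_iff_mem _).2 (hIJ i hPI)) hyf
      have h2 := add_mem h1 hb
      convert h2 using 1
      simp only [Submodule.subtype_apply]
      abel
    have : FiniteDimensional K (J N ⧸ S) :=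
      Module.Finite.of_injective ((ψ.restrictScalars K).codRestrict _ hrange) fun y z hyz =>
        hψ (congrArg Subtype.val hyz)
    have h1 := hfd (J N ⧸ S) (fun y => by
      obtain ⟨y, rfl⟩ := Submodule.Quotient.mk_surjective _ y
      rw [← Submodule.Quotient.mk_smul, Submodule.Quotient.mk_eq_zero]
      exact hPm i y) q hq hk (Submodule.Quotient.mk ⟨x, hx⟩)
    rwa [← Submodule.Quotient.mk_smul, Submodule.Quotient.mk_eq_zero] at h1
  obtain ⟨F, hF, hFk⟩ := exists_finiteDimensional_low (K := K) (h := h) (e := e) (m := m) hP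
    (rank (0, k₀))
  obtain ⟨X, hX⟩ := IsNoetherian.noetherian (J N)
  let W : Submodule K A := ⨆ x : X, F.map (LinearMap.mulRight K x.1)
  have hW : FiniteDimensional K W := inferInstance
  have hsplit : ∀ i, N ≤ i → (J N).restrictScalars K ≤ W ⊔ (J i).restrictScalars K := by
    intro i hi
    have hmul : ∀ x : X, ∀ a : A, a * x.1 ∈ W ⊔ (J i).restrictScalars K := by
      intro x a
      have hxN : x.1 ∈ J N := hX ▸ Submodule.subset_span x.2
      obtain ⟨l, hl⟩ := H.span a
      refine low_induction (f := LinearMap.mulRight K x.1) ?_ hl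
      rintro q s hq -
      rw [LinearMap.mulRight_apply]
      by_cases hk : k₀ ≤ q.1 + q.2
      · refine Submodule.mem_sup_right ?_
        rw [Submodule.restrictScalars_mem, mul_assoc]
        exact hkill i hi q hq hk _ ((J N).mul_mem_left _ hxN)
      · obtain ⟨f, hf, hff⟩ := hFk (m q * aeval h s)
          (mul_aeval_mem_low hq (rank_lt_of_degree_lt (by simpa using hk)) s)
        rw [← add_sub_cancel f (m q * aeval h s), add_mul]
        refine Submodule.add_mem_sup (Submodule.mem_iSup_of_mem x ⟨f, hf, rfl⟩) ?_
        obtain ⟨b, hb⟩ := Ideal.mem_span_singleton'.1 hff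
        rw [Submodule.restrictScalars_mem, ← hb, mul_assoc]
        exact (J i).mul_mem_left _ (hPm i _)
    intro y hy
    rw [Submodule.restrictScalars_mem, ← hX, Submodule.mem_span_iff_exists_finset_subset] at hy
    obtain ⟨c, t, ht, -, rfl⟩ := hy
    exact Submodule.sum_mem _ fun x hx => hmul ⟨x, ht hx⟩ (c x)
  obtain ⟨N', hN'⟩ := IsArtinian.monotone_stabilizes (R := K) (M := W)
    ⟨fun i => OrderDual.toDual (((J i).restrictScalars K).comap W.subtype),
      fun i j hij => Submodule.comap_mono (hJ hij)⟩
  refine ⟨N ⊔ N', fun i hi => le_antisymm (fun y hy => ?_) (hJ hi)⟩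
  obtain ⟨w, hw, z, hz, rfl⟩ := Submodule.mem_sup.1
    (hsplit i (le_sup_left.trans hi) (hJ le_sup_left hy))
  have hz' : z ∈ J i := hz
  have hw' : w ∈ J (N ⊔ N') := by simpa using sub_mem hy (hJ hi hz')
  have h1 : ((J (N ⊔ N')).restrictScalars K).comap W.subtype =
      ((J i).restrictScalars K).comap W.subtype :=
    OrderDual.toDual.injective ((hN' _ le_sup_right).symm.trans (hN' i (le_sup_right.trans hi)))
  have h2 : (⟨w, hw⟩ : W) ∈ ((J i).restrictScalars K).comap W.subtype := h1 ▸ hw'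
  exact add_mem h2 hz'

end IsSpanning
end LeadingTerm

namespace LeadingTerm

open Polynomial

lemma InMonolith.subtype {A M : Type} [Ring A] [AddCommGroup M] [Module A M] {v : M}
    (hv : InMonolith A v) {N : Submodule A M} (hvN : v ∈ N) : InMonolith A (⟨v, hvN⟩ : N) := by
  refine ⟨fun h0 => hv.1 (congrArg Subtype.val h0), fun x hx => ?_⟩
  obtain ⟨a, ha⟩ := hv.2 x.1 fun h0 => hx (Subtype.ext h0)
  exact ⟨a, Subtype.ext ha⟩

theorem IsSpanning.isArtinian_of_squarefree {K A : Type} [Field K] [Ring A] [Algebra K A] {h : A}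
    {e : ℕ} {m : ℕ × ℕ → A} (H : IsSpanning K h e m) (he : 0 < e) {P : K[X]} (hP : Squarefree P)
    (hcen : ∀ a, Commute (aeval h P) a) {k₀ : ℕ}
    (hfd : ∀ (Q : Type) [AddCommGroup Q] [Module A Q] [Module K Q] [IsScalarTower K A Q]
      [FiniteDimensional K Q], (∀ x : Q, aeval h P • x = 0) → ∀ q : ℕ × ℕ, e ∣ q.1 + q.2 →
        k₀ ≤ q.1 + q.2 → ∀ x : Q, m q • x = 0)
    {N : Type} [AddCommGroup N] [Module A N] [Module.Finite A N] {v : N} (hv : InMonolith A v)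
    (hPN : ∀ x : N, aeval h P • x = 0) : IsArtinian A N := by
  obtain ⟨X, hX⟩ := Module.Finite.fg_top (R := A) (M := N)
  have hcyc : ∀ x : N, IsArtinian A (A ∙ x) := by
    intro x
    obtain ⟨q, hq, htop⟩ := H.exists_lead_eq_top he hv hP hPN x
    have := H.isArtinian_quotient he hP.ne_zero hcen hfd (mem_annihilatorOf.2 (hPN x)) hq htop
    rw [← LinearMap.range_toSpanSingleton]
    exact (LinearMap.quotKerEquivRange (LinearMap.toSpanSingleton A N x)).isArtinian_iff.1 this
  have htop : (⨆ x : X, A ∙ x.1) = (⊤ : Submodule A N) := by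
    rw [← hX, Submodule.span_eq_iSup_of_singleton_spans, iSup_subtype]
    rfl
  have h1 : IsArtinian A (⨆ x : X, A ∙ x.1 : Submodule A N) := isArtinian_iSup
  rw [htop] at h1
  exact Submodule.topEquiv.isArtinian_iff.1 h1

section Normal

variable {A M : Type} [Ring A] [AddCommGroup M] [Module A M] {c : A}

/-- The elements killed by `c ^ k`, for `c` a normal element. -/
def kerPow (hc : ∀ a, ∃ a', c * a = a' * c) (k : ℕ) : Submodule A M where
  carrier := {x | c ^ k • x = 0}
  zero_mem' := smul_zero _
  add_mem' := by
    intro x y hx hy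
    rw [Set.mem_ofPred_eq] at *
    rw [smul_add, hx, hy, add_zero]
  smul_mem' := by
    intro a x hx
    have h1 : ∃ a', c ^ k * a = a' * c ^ k := by
      clear hx
      induction k generalizing a with
      | zero => exact ⟨a, by simp⟩
      | succ k ih =>
        obtain ⟨b, hb⟩ := hc a
        obtain ⟨b', hb'⟩ := ih b
        exact ⟨b', by rw [pow_succ, mul_assoc, hb, ← mul_assoc, hb', mul_assoc]⟩
    obtain ⟨a', ha'⟩ := h1
    rw [Set.mem_ofPred_eq] at *
    rw [← mul_smul, ha', mul_smul, hx, smul_zero]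

/-- The image of a submodule under a normal element. -/
def normalMap (hc : ∀ a, ∃ a', a * c = c * a') (L : Submodule A M) : Submodule A M where
  carrier := {y | ∃ x ∈ L, c • x = y}
  zero_mem' := ⟨0, zero_mem _, smul_zero _⟩
  add_mem' := by
    rintro _ _ ⟨x, hx, rfl⟩ ⟨y, hy, rfl⟩
    exact ⟨x + y, add_mem hx hy, smul_add _ _ _⟩
  smul_mem' := by
    rintro a _ ⟨x, hx, rfl⟩
    obtain ⟨a', ha'⟩ := hc a
    exact ⟨a' • x, L.smul_mem _ hx, by rw [← mul_smul, ← ha', mul_smul]⟩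

/-- If a normal element kills the monolith of a Noetherian module, then it suffices to show
that its kernel is Artinian. -/
theorem isArtinian_of_normal [IsNoetherian A M] (hl : ∀ a, ∃ a', c * a = a' * c)
    (hr : ∀ a, ∃ a', a * c = c * a') {v : M} (hv : InMonolith A v) (hcv : c • v = 0)
    (hker : ∀ N : Submodule A M, (∀ x ∈ N, c • x = 0) → v ∈ N → IsArtinian A N) :
    IsArtinian A M := by
  obtain ⟨k, hk⟩ := monotone_stabilizes_iff_noetherian.2 ‹IsNoetherian A M›
    ⟨fun k => kerPow hl k, monotone_nat_of_le_succ fun k x (hx : c ^ k • x = 0) => by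
      show c ^ (k + 1) • x = 0
      rw [pow_succ', mul_smul, hx, smul_zero]⟩
  have hrk : ∀ k, ∀ a, ∃ a', a * c ^ k = c ^ k * a' := by
    intro k
    induction k with
    | zero => exact fun a => ⟨a, by simp⟩
    | succ k ih =>
      intro a
      obtain ⟨b, hb⟩ := ih a
      obtain ⟨b', hb'⟩ := hr b
      exact ⟨b', by rw [pow_succ, ← mul_assoc, hb, mul_assoc, hb', mul_assoc]⟩
  have hnil : ∀ x : M, c ^ k • x = 0 := by
    intro x
    by_contra hx
    obtain ⟨a, ha⟩ := hv.2 _ hx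
    obtain ⟨a', ha'⟩ := hrk k a
    rw [← mul_smul, ha', mul_smul] at ha
    have h1 : a' • x ∈ kerPow (M := M) hl (k + 1) := by
      show c ^ (k + 1) • a' • x = 0
      rw [pow_succ', mul_smul, ha, hcv]
    have h2 : kerPow (M := M) hl k = kerPow hl (k + 1) := hk (k + 1) (Nat.le_succ k)
    rw [← h2] at h1
    exact hv.1 (ha ▸ h1)
  have hker1 : IsArtinian A (kerPow (M := M) hl 1) :=
    hker _ (fun x (hx : c ^ 1 • x = 0) => by rwa [pow_one] at hx)
      (show c ^ 1 • v = 0 by rwa [pow_one])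
  have key : ∀ j, ∀ L : ℕ → Submodule A M, Antitone L → (∀ i, ∀ x ∈ L i, c ^ j • x = 0) →
      ∃ N, ∀ i, N ≤ i → L N = L i := by
    intro j
    induction j with
    | zero =>
      intro L _ hL0
      refine ⟨0, fun i _ => ?_⟩
      have : ∀ i, L i = ⊥ := fun i => (Submodule.eq_bot_iff _).2 fun x hx => by
        simpa using hL0 i x hx
      rw [this, this]
    | succ j ih =>
      intro L hL hL0
      obtain ⟨N₁, h₁⟩ := ih (fun i => normalMap hr (L i))
        (fun i i' hi => fun _ ⟨x, hx, hxy⟩ => ⟨x, hL hi hx, hxy⟩) (by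
          rintro i _ ⟨x, hx, rfl⟩
          rw [← mul_smul, ← pow_succ, hL0 i x hx])
      obtain ⟨N₂, h₂⟩ := IsArtinian.monotone_stabilizes (R := A) (M := kerPow (M := M) hl 1)
        ⟨fun i => OrderDual.toDual ((L i).comap (kerPow (M := M) hl 1).subtype),
          fun i i' hi => Submodule.comap_mono (hL hi)⟩
      refine ⟨N₁ ⊔ N₂, fun i hi => le_antisymm (fun x hx => ?_) (hL hi)⟩
      have h3 : c • x ∈ normalMap hr (L i) := by
        rw [← h₁ i (le_sup_left.trans hi), h₁ (N₁ ⊔ N₂) le_sup_left]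
        exact ⟨x, hx, rfl⟩
      obtain ⟨y, hy, hyx⟩ := h3
      have h4 : x - y ∈ kerPow (M := M) hl 1 := by
        show c ^ 1 • (x - y) = 0
        rw [pow_one, smul_sub, hyx, sub_self]
      have h5 : (L (N₁ ⊔ N₂)).comap (kerPow (M := M) hl 1).subtype =
          (L i).comap (kerPow (M := M) hl 1).subtype :=
        OrderDual.toDual.injective
          ((h₂ _ le_sup_right).symm.trans (h₂ i (le_sup_right.trans hi)))
      have h6 : (⟨x - y, h4⟩ : kerPow (M := M) hl 1) ∈
          (L i).comap (kerPow (M := M) hl 1).subtype :=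
        h5 ▸ (sub_mem hx (hL hi hy))
      have h7 : x - y ∈ L i := h6
      simpa using add_mem h7 hy
  rw [← monotone_stabilizes_iff_artinian]
  intro f
  obtain ⟨N, hN⟩ := key k (fun i => OrderDual.ofDual (f i)) (fun i j hij => f.monotone hij)
    (fun i x _ => hnil x)
  exact ⟨N, fun i hi => OrderDual.ofDual.injective (hN i hi)⟩

end Normal

section FiniteOverCentre

variable {A M Z : Type} [Ring A] [AddCommGroup M] [Module A M] [CommRing Z] [IsNoetherianRing Z]
  [Module Z M] [Module.Finite Z M]

lemma isArtinian_of_pow_smul_eq_bot {m : Ideal Z} [m.IsMaximal] {k : ℕ}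
    (hk : m ^ k • (⊤ : Submodule Z M) = ⊥) : IsArtinian Z M := by
  have htors : Module.IsTorsionBySet Z M (m ^ k : Ideal Z) := by
    intro x a
    have h1 : a.1 • x ∈ m ^ k • (⊤ : Submodule Z M) :=
      Submodule.smul_mem_smul a.2 Submodule.mem_top
    rwa [hk, Submodule.mem_bot] at h1
  let := htors.module
  have : IsScalarTower Z (Z ⧸ m ^ k) M := htors.isScalarTower
  have : Ring.KrullDimLE 0 (Z ⧸ m ^ k) := Ring.KrullDimLE.mk₀ fun J hJ => by
    have hJ' := hJ.comap (Ideal.Quotient.mk (m ^ k))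
    have h1 : m ≤ J.comap (Ideal.Quotient.mk (m ^ k)) := by
      refine Ideal.IsPrime.le_of_pow_le (n := k) fun z hz => ?_
      rw [Ideal.mem_comap, Ideal.Quotient.eq_zero_iff_mem.2 hz]
      exact zero_mem _
    have h2 := Ideal.IsMaximal.eq_of_le ‹_› hJ'.ne_top h1
    have hmax : (J.comap (Ideal.Quotient.mk (m ^ k))).IsMaximal := by
      rw [← h2]
      assumption
    have h3 := Ideal.map_eq_top_or_isMaximal_of_surjective (Ideal.Quotient.mk (m ^ k))
      Ideal.Quotient.mk_surjective hmax
    rw [Ideal.map_comap_of_surjective _ Ideal.Quotient.mk_surjective] at h3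
    exact h3.resolve_left hJ.ne_top
  have : IsArtinianRing (Z ⧸ m ^ k) :=
    isArtinianRing_iff_isNoetherianRing_krullDimLE_zero.2 ⟨inferInstance, this⟩
  have : Module.Finite (Z ⧸ m ^ k) M := Module.Finite.of_restrictScalars_finite Z _ M
  exact isArtinian_of_surjective_algebraMap (R := Z ⧸ m ^ k)
    (Ideal.Quotient.mk_surjective (I := m ^ k))

/-- A module with monolith that is finite over a Noetherian ring acting centrally is Artinian. -/
theorem isArtinian_of_finite (hZA : ∀ z : Z, ∃ a : A, ∀ x : M, z • x = a • x)
    (hcomm : ∀ (z : Z) (a : A) (x : M), z • a • x = a • z • x) {v : M}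
    (hv : InMonolith A v) : IsArtinian A M := by
  let toZ : Submodule A M → Submodule Z M := fun L =>
    { L with
      smul_mem' := fun z x hx => by
        obtain ⟨a, ha⟩ := hZA z
        rw [ha]
        exact L.smul_mem a hx }
  have hnoeth : IsNoetherian Z M := inferInstance
  let V : Submodule Z M := toZ (A ∙ v)
  have hvV : v ∈ V := Submodule.mem_span_singleton_self v
  have hV : ∀ w ∈ V, ∃ a : A, a • v = w := fun w hw => Submodule.mem_span_singleton.1 hw
  have hmax : (annihilatorOf Z v).IsMaximal := by
    rw [Ideal.isMaximal_iff]
    refine ⟨by rw [mem_annihilatorOf, one_smul]; exact hv.1, fun J z hle hz hzJ => ?_⟩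
    rw [mem_annihilatorOf] at hz
    obtain ⟨b, hb⟩ := hv.2 _ hz
    have hVle : V ≤ Ideal.span {z} • V := by
      intro w hw
      obtain ⟨a, rfl⟩ := hV w hw
      rw [← hb, ← hcomm, ← hcomm, ← mul_smul]
      exact Submodule.smul_mem_smul (Ideal.mem_span_singleton_self z)
        ((A ∙ v).smul_mem _ (Submodule.mem_span_singleton_self v))
    obtain ⟨s, hs, hsV⟩ := Submodule.exists_sub_one_mem_and_smul_eq_zero_of_fg_of_le_smul _ V
      (IsNoetherian.noetherian V) hVle
    have h1 : s ∈ J := hle (mem_annihilatorOf.2 (hsV v hvV))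
    have h2 : s - 1 ∈ J := (Ideal.span_singleton_le_iff_mem _).2 hzJ hs
    simpa using sub_mem h1 h2
  obtain ⟨k, hk⟩ := (annihilatorOf Z v).exists_pow_inf_eq_pow_smul V
  have hbot : annihilatorOf Z v ^ (k + 1) • (⊤ : Submodule Z M) = ⊥ := by
    by_contra hne
    obtain ⟨y, hy, hy0⟩ := Submodule.exists_mem_ne_zero_of_ne_bot hne
    obtain ⟨a, ha⟩ := hv.2 y hy0
    have hmem : a • y ∈ annihilatorOf Z v ^ (k + 1) • (⊤ : Submodule Z M) := by
      refine Submodule.smul_induction_on hy (fun z hz x _ => ?_) (fun x y hx hy => ?_)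
      · rw [← hcomm]
        exact Submodule.smul_mem_smul hz Submodule.mem_top
      · rw [smul_add]
        exact add_mem hx hy
    have h1 : v ∈ annihilatorOf Z v ^ (k + 1) • (⊤ : Submodule Z M) ⊓ V := ⟨ha ▸ hmem, hvV⟩
    rw [hk (k + 1) (Nat.le_succ k), Nat.add_sub_cancel_left, pow_one] at h1
    have h2 : annihilatorOf Z v • (annihilatorOf Z v ^ k • (⊤ : Submodule Z M) ⊓ V) ≤ ⊥ := by
      rw [Submodule.smul_le]
      intro z hz w hw
      obtain ⟨b, rfl⟩ := hV w hw.2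
      rw [hcomm, mem_annihilatorOf.1 hz, smul_zero]
      exact zero_mem _
    exact hv.1 (h2 h1)
  have hart : IsArtinian Z M := isArtinian_of_pow_smul_eq_bot hbot
  rw [← monotone_stabilizes_iff_artinian]
  intro f
  obtain ⟨N, hN⟩ := IsArtinian.monotone_stabilizes (R := Z) (M := M)
    ⟨fun i => OrderDual.toDual (toZ (OrderDual.ofDual (f i))), fun i j hij => f.monotone hij⟩
  refine ⟨N, fun i hi => OrderDual.ofDual.injective (SetLike.ext fun x => ?_)⟩
  exact SetLike.ext_iff.1 (OrderDual.toDual.injective (hN i hi)) x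

end FiniteOverCentre

end LeadingTerm

namespace LeadingTerm

open Polynomial

lemma exists_fg_stable {Z M : Type} [CommRing Z] [AddCommGroup M] [Module Z M]
    {g : Module.End Z M} (hg : IsIntegral Z g) {S : Submodule Z M} (hS : S.FG) :
    ∃ S' : Submodule Z M, S'.FG ∧ (∀ i : ℕ, ∀ x ∈ S, (g ^ i) x ∈ S') ∧ (∀ x ∈ S', g x ∈ S') ∧
      ∀ T : Submodule Z M, (∀ i : ℕ, ∀ x ∈ S, (g ^ i) x ∈ T) → S' ≤ T := by
  have hpow : ∀ i : ℕ, ∀ x ∈ S, (g ^ i) x ∈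
      Submodule.map₂ LinearMap.id (Algebra.adjoin Z {g}).toSubmodule S := fun i x hx =>
    Submodule.apply_mem_map₂ LinearMap.id
      (pow_mem (Algebra.self_mem_adjoin_singleton Z g) i : g ^ i ∈ Algebra.adjoin Z {g}) hx
  have hle : ∀ T : Submodule Z M, (∀ i : ℕ, ∀ x ∈ S, (g ^ i) x ∈ T) →
      Submodule.map₂ LinearMap.id (Algebra.adjoin Z {g}).toSubmodule S ≤ T := by
    intro T hT
    rw [Submodule.map₂_le]
    intro f hf x hx
    rw [Subalgebra.mem_toSubmodule, Algebra.adjoin_singleton_eq_range_aeval] at hf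
    obtain ⟨p, rfl⟩ := hf
    rw [LinearMap.id_apply, AlgHom.toRingHom_eq_coe, RingHom.coe_coe, aeval_eq_sum_range,
      LinearMap.sum_apply]
    exact Submodule.sum_mem _ fun i _ => T.smul_mem _ (hT i x hx)
  refine ⟨_, hg.fg_adjoin_singleton.map₂ LinearMap.id hS, hpow, fun y hy => ?_, hle⟩
  refine hle ((Submodule.map₂ LinearMap.id (Algebra.adjoin Z {g}).toSubmodule S).comap g)
    (fun i x hx => ?_) hy
  rw [Submodule.mem_comap, ← Module.End.mul_apply, ← pow_succ']
  exact hpow _ x hx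

variable {K A : Type} [Field K] [Ring A] [Algebra K A]

/-- Elements acting centrally on a module generate a commutative Noetherian ring of operators. -/
lemma exists_centralAction {M : Type} [AddCommGroup M] [Module K M] [Module A M]
    [IsScalarTower K A M] {k : ℕ} (g : Fin k → A)
    (hg : ∀ i (a : A) (x : M), g i • a • x = a • g i • x) :
    ∃ ζ : MvPolynomial (Fin k) K →ₐ[K] Module.End K M,
      (∀ i (x : M), ζ (MvPolynomial.X i) x = g i • x) ∧
      (∀ z, ∃ a : A, ∀ x : M, ζ z x = a • x) ∧
      ∀ z (a : A) (x : M), ζ z (a • x) = a • ζ z x := by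
  let ρ : A →ₐ[K] Module.End K M := Algebra.lsmul K K M
  let c : Fin k → Subalgebra.center K ρ.range := fun i => ⟨⟨ρ (g i), g i, rfl⟩, by
    rw [Subalgebra.mem_center_iff]
    rintro ⟨_, a, rfl⟩
    refine Subtype.ext (LinearMap.ext fun x => ?_)
    exact (hg i a x).symm⟩
  let ζ : MvPolynomial (Fin k) K →ₐ[K] Subalgebra.center K ρ.range := MvPolynomial.aeval c
  refine ⟨ρ.range.val.comp ((Subalgebra.center K ρ.range).val.comp ζ), fun i x => ?_,
    fun z => ?_, fun z a x => ?_⟩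
  · simp only [AlgHom.comp_apply, ζ, MvPolynomial.aeval_X]
    rfl
  · obtain ⟨a, ha⟩ := (ζ z).1.2
    exact ⟨a, fun x => (LinearMap.congr_fun ha x).symm⟩
  · have h1 := Subalgebra.mem_center_iff.1 (ζ z).2 ⟨ρ a, a, rfl⟩
    exact (LinearMap.congr_fun (congrArg Subtype.val h1) x).symm

/-- The relations satisfied by the generators `d`, `u` and the element `w = du - r ud` of a
down-up algebra with `X ^ 2 - α X - β = (X - r) ^ 2`. -/
structure DownUpTriple (d u w : A) (r γ : K) : Prop where
  dw : d * w = (r • w + γ • 1) * d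
  wu : w * u = u * (r • w + γ • 1)
  du : d * u = r • (u * d) + w

namespace DownUpTriple

variable {d u w : A} {r γ : K} (R : DownUpTriple d u w r γ)
include R

open MulOpposite in
lemma op : DownUpTriple (op u) (op d) (op w) r γ where
  dw := by
    rw [← op_mul, R.wu, op_mul]
    simp
  wu := by
    rw [← op_mul, R.dw, op_mul]
    simp
  du := by
    rw [← op_mul, R.du, op_add, op_smul, op_mul]

lemma d_pow_mul_w (k : ℕ) :
    d ^ k * w = (r ^ k • w + (γ * ∑ i ∈ Finset.range k, r ^ i) • 1) * d ^ k := by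
  induction k with
  | zero => simp
  | succ k ih =>
    have h1 : d ^ (k + 1) * w = (r • (d ^ k * w) + γ • d ^ k) * d := by
      rw [pow_succ, mul_assoc, R.dw, ← mul_assoc, mul_add, mul_smul_comm, mul_smul_comm, mul_one]
    rw [h1, ih, geom_sum_succ, pow_succ]
    simp only [add_mul, smul_mul_assoc, one_mul, mul_assoc, ← pow_succ]
    module

lemma d_pow_mul_u (k : ℕ) :
    d ^ (k + 1) * u = r ^ (k + 1) • (u * d ^ (k + 1)) + (((k + 1 : ℕ) * r ^ k) • w +
      (γ * ∑ j ∈ Finset.range k, (j + 1 : ℕ) * r ^ j) • 1) * d ^ k := by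
  induction k with
  | zero => simp [R.du]
  | succ k ih =>
    have h1 : d * (w * d ^ k) = r • (w * d ^ (k + 1)) + γ • d ^ (k + 1) := by
      rw [← mul_assoc, R.dw, mul_assoc, ← pow_succ', add_mul, smul_mul_assoc, smul_mul_assoc,
        one_mul]
    have h2 : d * (u * d ^ (k + 1)) = r • (u * d ^ (k + 2)) + w * d ^ (k + 1) := by
      rw [← mul_assoc, R.du, add_mul, smul_mul_assoc, mul_assoc, ← pow_succ']
    rw [pow_succ' d (k + 1), mul_assoc, ih, mul_add, mul_smul_comm, h2, Finset.sum_range_succ]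
    simp only [add_mul, mul_add, smul_mul_assoc, mul_smul_comm, one_mul, h1, ← pow_succ']
    push_cast
    module

lemma w_mul_u_pow (k : ℕ) :
    w * u ^ k = u ^ k * (r ^ k • w + (γ * ∑ i ∈ Finset.range k, r ^ i) • 1) := by
  have := congrArg MulOpposite.unop (R.op.d_pow_mul_w k)
  simpa using this

lemma d_mul_u_pow (k : ℕ) :
    d * u ^ (k + 1) = r ^ (k + 1) • (u ^ (k + 1) * d) + u ^ k * (((k + 1 : ℕ) * r ^ k) • w +
      (γ * ∑ j ∈ Finset.range k, (j + 1 : ℕ) * r ^ j) • 1) := by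
  have := congrArg MulOpposite.unop (R.op.d_pow_mul_u k)
  simpa using this

end DownUpTriple

end LeadingTerm

namespace LeadingTerm

open Polynomial

variable {K A : Type} [Field K] [Ring A] [Algebra K A]

namespace DownUpTriple

variable {d u w : A} {r γ : K} (R : DownUpTriple d u w r γ)
include R

/-- A finitely generated monolithic module on which powers of `d` and `u` and a monic polynomial
in `w` act centrally is finite over a commutative Noetherian ring, hence Artinian. -/
theorem isArtinian_of_central (hr0 : r ≠ 0) (hgen : Algebra.adjoin K {d, u} = ⊤)
    {M : Type} [AddCommGroup M] [Module K M] [Module A M] [IsScalarTower K A M]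
    [Module.Finite A M] {N : ℕ} (hN : 0 < N)
    (hd : ∀ (a : A) (x : M), d ^ N • a • x = a • d ^ N • x)
    (hu : ∀ (a : A) (x : M), u ^ N • a • x = a • u ^ N • x)
    {G : K[X]} (hG : G.Monic) (hG0 : G.natDegree ≠ 0)
    (hw : ∀ (a : A) (x : M), aeval w G • a • x = a • aeval w G • x)
    {v : M} (hv : InMonolith A v) : IsArtinian A M := by
  obtain ⟨ζ, hζ, hζA, hζc⟩ := exists_centralAction (K := K) (M := M) ![d ^ N, u ^ N, aeval w G] (by
    intro i a x
    fin_cases i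
    · exact hd a x
    · exact hu a x
    · exact hw a x)
  let _ : Module (MvPolynomial (Fin 3) K) M := Module.compHom M (ζ : _ →+* Module.End K M)
  have hsmul : ∀ (z : MvPolynomial (Fin 3) K) (x : M), z • x = ζ z x := fun _ _ => rfl
  have : SMulCommClass A (MvPolynomial (Fin 3) K) M := ⟨fun a z x => (hζc z a x).symm⟩
  have hKsmul : ∀ (c : K) (x : M), (algebraMap K (MvPolynomial (Fin 3) K) c) • x = c • x := by
    intro c x
    rw [hsmul, AlgHom.commutes, Module.algebraMap_end_apply]
  have hK : ∀ (T : Submodule (MvPolynomial (Fin 3) K) M) (c : K) (x : M), x ∈ T → c • x ∈ T := by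
    intro T c x hx
    rw [← hKsmul]
    exact T.smul_mem _ hx
  let L : A →+* Module.End (MvPolynomial (Fin 3) K) M := Module.toModuleEnd _ M
  have hL : ∀ a (x : M), L a x = a • x := fun _ _ => rfl
  have hLpow : ∀ a (i : ℕ) (x : M), (L a ^ i) x = a ^ i • x := by
    intro a i x
    rw [← map_pow, hL]
  have hdi : IsIntegral (MvPolynomial (Fin 3) K) (L d) := by
    refine ⟨X ^ N - C (MvPolynomial.X 0), monic_X_pow_sub_C _ hN.ne', ?_⟩
    rw [eval₂_sub, eval₂_X_pow, eval₂_C, sub_eq_zero]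
    ext x
    rw [hLpow, Module.algebraMap_end_apply, hsmul, hζ]
    rfl
  have hui : IsIntegral (MvPolynomial (Fin 3) K) (L u) := by
    refine ⟨X ^ N - C (MvPolynomial.X 1), monic_X_pow_sub_C _ hN.ne', ?_⟩
    rw [eval₂_sub, eval₂_X_pow, eval₂_C, sub_eq_zero]
    ext x
    rw [hLpow, Module.algebraMap_end_apply, hsmul, hζ]
    rfl
  have hwi : IsIntegral (MvPolynomial (Fin 3) K) (L w) := by
    refine ⟨G.map (algebraMap K _) - C (MvPolynomial.X 2),
      (hG.map _).sub_of_left (degree_C_le.trans_lt ?_), ?_⟩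
    · rw [degree_map]
      exact natDegree_pos_iff_degree_pos.1 (Nat.pos_of_ne_zero hG0)
    · rw [eval₂_sub, eval₂_C, eval₂_map, sub_eq_zero]
      ext x
      rw [Module.algebraMap_end_apply, hsmul, hζ]
      change _ = aeval w G • x
      rw [eval₂_eq_sum_range, aeval_eq_sum_range, LinearMap.sum_apply, Finset.sum_smul]
      refine Finset.sum_congr rfl fun i _ => ?_
      rw [RingHom.comp_apply, Module.End.mul_apply, Module.algebraMap_end_apply, hKsmul, hLpow,
        smul_assoc]
  obtain ⟨s, hs⟩ := Module.Finite.fg_top (R := A) (M := M)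
  obtain ⟨S₁, hS₁, hS₁s, hS₁w, -⟩ := exists_fg_stable hwi
    (Submodule.fg_span (R := MvPolynomial (Fin 3) K) s.finite_toSet)
  obtain ⟨S₂, hS₂, hS₂s, hS₂d, hS₂l⟩ := exists_fg_stable hdi hS₁
  have hS₂w : ∀ x ∈ S₂, w • x ∈ S₂ := by
    refine hS₂l (S₂.comap (L w)) fun i x hx => ?_
    rw [Submodule.mem_comap, hL, hLpow]
    have h1 : w * d ^ i = (r ^ i)⁻¹ • (d ^ i * w) -
        ((r ^ i)⁻¹ * (γ * ∑ j ∈ Finset.range i, r ^ j)) • d ^ i := by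
      rw [R.d_pow_mul_w, add_mul, smul_add, smul_mul_assoc, smul_mul_assoc, one_mul, smul_smul,
        smul_smul, inv_mul_cancel₀ (pow_ne_zero i hr0), one_smul, add_sub_cancel_right]
    rw [← mul_smul, h1, sub_smul, smul_assoc, smul_assoc, mul_smul]
    refine sub_mem (hK _ _ _ ?_) (hK _ _ _ ?_)
    · rw [← hLpow]
      exact hS₂s i _ (hS₁w x hx)
    · rw [← hLpow]
      exact hS₂s i _ hx
  obtain ⟨S₃, hS₃, hS₃s, hS₃u, hS₃l⟩ := exists_fg_stable hui hS₂
  have hS₃d : ∀ x ∈ S₃, d • x ∈ S₃ := by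
    refine hS₃l (S₃.comap (L d)) fun i x hx => ?_
    rw [Submodule.mem_comap, hL, hLpow, ← mul_smul]
    rcases i with _ | i
    · rw [pow_zero, mul_one]
      exact hS₃s 0 _ (hS₂d x hx)
    · rw [R.d_mul_u_pow, add_smul, smul_assoc, mul_smul, mul_smul, ← hLpow, ← hLpow]
      refine add_mem (hK _ _ _ (hS₃s _ _ (hS₂d x hx))) (hS₃s _ _ ?_)
      rw [add_smul, smul_assoc, smul_assoc, one_smul]
      exact add_mem (hK _ _ _ (hS₂w x hx)) (hK _ _ _ hx)
  have hstable : ∀ a : A, ∀ x ∈ S₃, a • x ∈ S₃ := by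
    intro a
    have ha : a ∈ Algebra.adjoin K {d, u} := hgen ▸ Algebra.mem_top
    induction ha using Algebra.adjoin_induction with
    | mem a ha =>
      rcases ha with rfl | rfl
      · exact hS₃d
      · exact hS₃u
    | algebraMap c =>
      intro x hx
      rw [algebraMap_smul]
      exact hK _ _ _ hx
    | add a b _ _ iha ihb =>
      intro x hx
      rw [add_smul]
      exact add_mem (iha x hx) (ihb x hx)
    | mul a b _ _ iha ihb =>
      intro x hx
      rw [mul_smul]
      exact iha _ (ihb x hx)
  have htop : S₃ = ⊤ := by
    rw [eq_top_iff]
    rintro x -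
    have hx : x ∈ Submodule.span A (s : Set M) := hs ▸ Submodule.mem_top
    induction hx using Submodule.span_induction with
    | mem x hx =>
      have h1 := hS₁s 0 x (Submodule.subset_span hx)
      have h2 := hS₂s 0 _ h1
      simpa using hS₃s 0 _ h2
    | zero => exact zero_mem _
    | add x y _ _ hx hy => exact add_mem hx hy
    | smul a x _ hx => exact hstable a x hx
  have : Module.Finite (MvPolynomial (Fin 3) K) M := ⟨htop ▸ hS₃⟩
  exact isArtinian_of_finite (Z := MvPolynomial (Fin 3) K) hζA hζc hv

end DownUpTriple

end LeadingTerm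

namespace LeadingTerm

open Polynomial

variable {K A : Type} [Field K] [Ring A] [Algebra K A]

lemma semiconjBy_aeval {a x y : A} (hxy : SemiconjBy a x y) (q : K[X]) :
    SemiconjBy a (aeval x q) (aeval y q) := by
  induction q using Polynomial.induction_on' with
  | add p q hp hq =>
    rw [map_add, map_add]
    exact hp.add_right hq
  | monomial k c =>
    rw [aeval_monomial, aeval_monomial]
    exact SemiconjBy.mul_right (Algebra.commutes c a).symm (hxy.pow_right k)

lemma commute_of_adjoin_eq_top {d u : A} (hgen : Algebra.adjoin K {d, u} = ⊤) {z : A}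
    (hd : Commute z d) (hu : Commute z u) (a : A) : Commute z a := by
  have ha : a ∈ Algebra.adjoin K {d, u} := hgen ▸ Algebra.mem_top
  induction ha using Algebra.adjoin_induction with
  | mem a ha =>
    rcases ha with rfl | rfl
    · exact hd
    · exact hu
  | algebraMap c => exact (Algebra.commutes c z).symm
  | add a b _ _ ha hb => exact ha.add_right hb
  | mul a b _ _ ha hb => exact ha.mul_right hb

lemma pow_mul_of_mul_eq_add {a b u : A} (hab : Commute a b) (hau : a * u = u * a + b) (j : ℕ) :
    a ^ (j + 1) * u = u * a ^ (j + 1) + ((j + 1 : ℕ) : K) • (a ^ j * b) := by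
  induction j with
  | zero => simp [hau]
  | succ j ih =>
    rw [pow_succ' a (j + 1), mul_assoc, ih, mul_add, ← mul_assoc a u, hau, add_mul,
      mul_smul_comm, ← mul_assoc a _ b, ← pow_succ', ← (hab.pow_left (j + 1)).eq, mul_assoc]
    push_cast
    module

lemma commute_pow_of_charP {p : ℕ} [CharP K p] (hp : p ≠ 0) {a b u : A} (hab : Commute a b)
    (hau : a * u = u * a + b) : Commute (a ^ p) u := by
  obtain ⟨j, rfl⟩ := Nat.exists_eq_succ_of_ne_zero hp
  rw [commute_iff_eq, Nat.succ_eq_add_one, pow_mul_of_mul_eq_add (K := K) hab hau,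
    CharP.cast_eq_zero, zero_smul, add_zero]

namespace DownUpTriple

variable {d u w : A} {r γ : K} (R : DownUpTriple d u w r γ)
include R

lemma d_mul_aeval (q : K[X]) :
    d * aeval w q = aeval w (q.comp (C r * X + C γ)) * d := by
  rw [aeval_comp]
  refine semiconjBy_aeval ?_ q
  simpa [SemiconjBy, Algebra.smul_def] using R.dw

lemma aeval_mul_u (q : K[X]) :
    aeval w q * u = u * aeval w (q.comp (C r * X + C γ)) := by
  rw [aeval_comp]
  refine (semiconjBy_aeval ?_ q).symm
  simpa [SemiconjBy, Algebra.smul_def] using R.wu.symm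

lemma commute_d_pow_of_charP {p : ℕ} [CharP K p] (hp : p ≠ 0) {n : ℕ} (hn : 0 < n)
    (hr : r ^ n = 1) : Commute (d ^ (n * p * p)) u := by
  have hnp : 0 < n * p := Nat.mul_pos hn (Nat.pos_of_ne_zero hp)
  obtain ⟨k, hk⟩ := Nat.exists_eq_succ_of_ne_zero hnp.ne'
  have h1 := R.d_pow_mul_u k
  rw [← Nat.succ_eq_add_one, ← hk, pow_mul r, hr, one_pow, one_smul, Nat.cast_mul,
    CharP.cast_eq_zero K p, mul_zero, zero_mul, zero_smul, zero_add, smul_mul_assoc, one_mul] at h1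
  rw [pow_mul]
  exact commute_pow_of_charP (K := K) hp (((Commute.refl d).pow_pow _ _).smul_right _) h1

theorem isArtinian_of_charP {p : ℕ} [CharP K p] (hp : p ≠ 0) {n : ℕ} (hn : 0 < n)
    (hr : r ^ n = 1) (hgen : Algebra.adjoin K {d, u} = ⊤)
    {M : Type} [AddCommGroup M] [Module K M] [Module A M] [IsScalarTower K A M]
    [Module.Finite A M] {v : M} (hv : InMonolith A v) : IsArtinian A M := by
  have hr0 : r ≠ 0 := by
    rintro rfl
    simp [hn.ne'] at hr
  have hnp : 0 < n * p := Nat.mul_pos hn (Nat.pos_of_ne_zero hp)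
  have hS : ∑ i ∈ Finset.range (n * p), r ^ i = 0 := by
    rcases eq_or_ne r 1 with rfl | hr1
    · simp
    · rw [geom_sum_eq hr1, pow_mul, hr, one_pow, sub_self, zero_div]
  let τ : ℕ → K[X] := fun i => X + C (γ * (∑ j ∈ Finset.range i, r ^ j) * (r ^ i)⁻¹)
  have hτ : ∀ i, (τ i).comp (C r * X + C γ) = C r * τ (i + 1) := by
    intro i
    have h1 : γ + γ * (∑ j ∈ Finset.range i, r ^ j) * (r ^ i)⁻¹ =
        r * (γ * (∑ j ∈ Finset.range (i + 1), r ^ j) * (r ^ (i + 1))⁻¹) := by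
      rw [Finset.sum_range_succ]
      field_simp
      ring
    simp only [τ, add_comp, X_comp, C_comp, mul_add, ← C_mul, ← h1]
    simp only [C_add, add_assoc]
  let G : K[X] := ∏ i ∈ Finset.range (n * p), τ i
  have hG : G.comp (C r * X + C γ) = G := by
    have h0 : τ (n * p) = τ 0 := by simp only [τ, hS]; simp
    rw [Polynomial.prod_comp, Finset.prod_congr rfl fun i _ => hτ i, Finset.prod_mul_distrib,
      Finset.prod_const, Finset.card_range, ← C_pow, pow_mul, hr, one_pow, C_1, one_mul]
    have h1 := Finset.prod_range_succ τ (n * p)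
    rw [Finset.prod_range_succ', h0] at h1
    exact mul_right_cancel₀ (monic_X_add_C _).ne_zero h1
  have hGm : G.Monic := monic_prod_of_monic _ _ fun i _ => monic_X_add_C _
  have hGd : G.natDegree = n * p := by
    rw [natDegree_prod_of_monic _ _ fun i _ => monic_X_add_C _,
      Finset.sum_congr rfl fun i _ => natDegree_X_add_C _]
    simp
  have hcomm : ∀ {z : A}, Commute z d → Commute z u → ∀ (a : A) (x : M),
      z • a • x = a • z • x := by
    intro z hd hu a x
    rw [← mul_smul, ← mul_smul, (commute_of_adjoin_eq_top hgen hd hu a).eq]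
  refine R.isArtinian_of_central hr0 hgen (Nat.mul_pos hnp (Nat.pos_of_ne_zero hp))
    (hcomm ((Commute.refl d).pow_left _) (R.commute_d_pow_of_charP hp hn hr))
    (hcomm ?_ ((Commute.refl u).pow_left _)) hGm (hGd ▸ hnp.ne') (hcomm ?_ ?_) hv
  · have := R.op.commute_d_pow_of_charP hp hn hr
    exact MulOpposite.op_injective (by simpa using this.eq.symm)
  · have := R.d_mul_aeval G
    rw [hG] at this
    exact this.symm
  · have := R.aeval_mul_u G
    rwa [hG] at this

end DownUpTriple

end LeadingTerm

namespace LeadingTerm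

open Polynomial

variable {K A : Type} [Field K] [Ring A] [Algebra K A] {h : A} {e : ℕ} {m : ℕ × ℕ → A}

/-- Left multiplication by `x` sends `m q` to a nonzero multiple of `m (q + δ)`, up to terms of
smaller degree. -/
structure HasLead (K : Type) [Field K] [Algebra K A] (h : A) (e : ℕ) (m : ℕ × ℕ → A) (x : A)
    (δ : ℕ × ℕ) : Prop where
  dvd : e ∣ δ.1 + δ.2
  lead : ∀ q : ℕ × ℕ, e ∣ q.1 + q.2 → ∃ c : K, c ≠ 0 ∧
    x * m q - c • m (q + δ) ∈ low (K := K) h e m (rank (0, q.1 + q.2 + (δ.1 + δ.2)))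

lemma rank_lt_rank_zero {q : ℕ × ℕ} {k : ℕ} (hq : q.1 + q.2 < k) : rank q < rank (0, k) :=
  rank_lt_of_degree_lt (by simpa using hq)

lemma degree_lt_of_rank_lt {q : ℕ × ℕ} {k : ℕ} (hq : rank q < rank (0, k)) :
    q.1 + q.2 < k := by
  have := rank_lt_iff.1 hq
  simp only [zero_add] at this
  omega

lemma rank_zero_le {k l : ℕ} (hkl : k ≤ l) : rank (0, k) ≤ rank (0, l) := by
  rcases hkl.eq_or_lt with rfl | hlt
  · exact le_rfl
  · exact (rank_lt_rank_zero (by simpa using hlt)).le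

lemma rank_zero_degree_le (q : ℕ × ℕ) : rank (0, q.1 + q.2) ≤ rank q := by
  by_contra! hcon
  exact (degree_lt_of_rank_lt hcon).ne rfl

namespace HasLead

lemma one (h : A) (e : ℕ) (m : ℕ × ℕ → A) : HasLead K h e m 1 0 where
  dvd := by simp
  lead q _ := ⟨1, one_ne_zero, by simp⟩

lemma mul_low {x : A} {δ : ℕ × ℕ} (hx : HasLead K h e m x δ) {k : ℕ} {a : A}
    (ha : a ∈ low (K := K) h e m (rank (0, k))) :
    x * a ∈ low (K := K) h e m (rank (0, k + (δ.1 + δ.2))) := by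
  refine low_induction (f := LinearMap.mulLeft K x) ?_ ha
  intro q s he hr
  rw [LinearMap.mulLeft_apply, ← mul_assoc]
  obtain ⟨c, -, hc⟩ := hx.lead q he
  have hq := degree_lt_of_rank_lt hr
  refine low_mul_aeval ?_ s
  have h1 := mul_aeval_mem_low (K := K) (h := h) (m := m) (e := e) (q := q + δ)
    (k := rank (0, k + (δ.1 + δ.2))) (by
      simp only [Prod.fst_add, Prod.snd_add]
      rw [add_add_add_comm]
      exact dvd_add he hx.dvd) (rank_lt_rank_zero (by
        simp only [Prod.fst_add, Prod.snd_add]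
        omega)) (C c)
  rw [aeval_C, ← Algebra.commutes, ← Algebra.smul_def] at h1
  simpa using add_mem (low_mono (rank_zero_le (by omega)) hc) h1

lemma mul {x y : A} {δ ε : ℕ × ℕ} (hx : HasLead K h e m x δ) (hy : HasLead K h e m y ε) :
    HasLead K h e m (x * y) (δ + ε) where
  dvd := by
    simp only [Prod.fst_add, Prod.snd_add]
    rw [add_add_add_comm]
    exact dvd_add hx.dvd hy.dvd
  lead q hq := by
    obtain ⟨b, hb0, hb⟩ := hy.lead q hq
    obtain ⟨c, hc0, hc⟩ := hx.lead (q + ε) (by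
      simp only [Prod.fst_add, Prod.snd_add]
      rw [add_add_add_comm]
      exact dvd_add hq hy.dvd)
    refine ⟨b * c, mul_ne_zero hb0 hc0, ?_⟩
    have h1 := add_mem (low_mono (rank_zero_le (l := q.1 + q.2 + ((δ + ε).1 + (δ + ε).2)) (by
        simp only [Prod.fst_add, Prod.snd_add]; omega)) (hx.mul_low hb))
      (low_mono (rank_zero_le (l := q.1 + q.2 + ((δ + ε).1 + (δ + ε).2)) (by
        simp only [Prod.fst_add, Prod.snd_add]; omega)) (Submodule.smul_mem _ b hc))
    convert h1 using 1
    rw [add_comm δ ε, ← add_assoc q, mul_sub, mul_smul_comm, mul_assoc, smul_sub, smul_smul]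
    abel

lemma pow {x : A} {δ : ℕ × ℕ} (hx : HasLead K h e m x δ) (k : ℕ) :
    HasLead K h e m (x ^ k) (k • δ) := by
  induction k with
  | zero => simpa using one h e m
  | succ k ih =>
    rw [pow_succ, succ_nsmul]
    exact ih.mul hx

end HasLead

lemma isSpanning_of_hasLead {d u : A} (hgen : Algebra.adjoin K {d, u} = ⊤) (one : m 0 = 1)
    (left : ∀ (s : K[X]) q, ∃ s' : K[X], aeval h s * m q = m q * aeval h s')
    (right : ∀ (s : K[X]) q, ∃ s' : K[X], m q * aeval h s = aeval h s' * m q)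
    {δ ε : ℕ × ℕ} (hd : HasLead K h e m d δ) (hu : HasLead K h e m u ε)
    (hm : ∀ q : ℕ × ℕ, e ∣ q.1 + q.2 → HasLead K h e m (m q) q) : IsSpanning K h e m where
  one := one
  left := left
  right := right
  mul p q hp hq := by
    obtain ⟨c, hc0, hc⟩ := (hm p hp).lead q hq
    refine ⟨c, hc0, ?_⟩
    rw [add_comm p q]
    refine low_mono (le_trans (rank_zero_le ?_) (rank_zero_degree_le _)) hc
    simp only [Prod.fst_add, Prod.snd_add]
    omega
  span a := by
    suffices H : ∀ b : A, (∃ k, b ∈ low (K := K) h e m (rank (0, k))) →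
        ∃ k, a * b ∈ low (K := K) h e m (rank (0, k)) by
      obtain ⟨k, hk⟩ := H 1 ⟨1, by
        have := mul_aeval_mem_low (K := K) (h := h) (m := m) (e := e) (q := 0) (by simp)
          (rank_lt_rank_zero (k := 1) (by simp)) 1
        rwa [one, map_one, one_mul] at this⟩
      exact ⟨_, by simpa using hk⟩
    have ha : a ∈ Algebra.adjoin K {d, u} := hgen ▸ Algebra.mem_top
    induction ha using Algebra.adjoin_induction with
    | mem a ha =>
      rintro b ⟨k, hk⟩
      rcases ha with rfl | rfl
      · exact ⟨_, hd.mul_low hk⟩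
      · exact ⟨_, hu.mul_low hk⟩
    | algebraMap c =>
      rintro b ⟨k, hk⟩
      exact ⟨k, by rw [← Algebra.smul_def]; exact Submodule.smul_mem _ c hk⟩
    | add a a' _ _ ha ha' =>
      intro b hb
      obtain ⟨k, hk⟩ := ha b hb
      obtain ⟨l, hl⟩ := ha' b hb
      refine ⟨max k l, ?_⟩
      rw [add_mul]
      exact add_mem (low_mono (rank_zero_le (le_max_left _ _)) hk)
        (low_mono (rank_zero_le (le_max_right _ _)) hl)
    | mul a a' _ _ ha ha' =>
      intro b hb
      rw [mul_assoc]
      exact ha _ (ha' b hb)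

lemma InMonolith.smul {M : Type} [AddCommGroup M] [Module A M] {v : M} (hv : InMonolith A v)
    {c : A} (hc : c • v ≠ 0) : InMonolith A (c • v) :=
  ⟨hc, fun x hx => by
    obtain ⟨a, ha⟩ := hv.2 x hx
    exact ⟨c * a, by rw [mul_smul, ha]⟩⟩

lemma InMonolith.exists_irreducible {M : Type} [AddCommGroup M] [Module A M] {v : M}
    (hv : InMonolith A v) {z : A} (hz : ∀ a, Commute z a) {p : K[X]} (hp : p ≠ 0)
    (hpv : aeval z p • v = 0) : ∃ P : K[X], Irreducible P ∧ aeval z P • v = 0 := by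
  induction p using WfDvdMonoid.induction_on_irreducible with
  | zero => exact absurd rfl hp
  | unit p hu =>
    refine absurd ?_ hv.1
    obtain ⟨b, hb⟩ := hu.exists_left_inv
    rw [← one_smul A v, ← map_one (aeval (R := K) z), ← hb, map_mul, mul_smul, hpv, smul_zero]
  | mul p i hp0 hi ih =>
    by_cases hiv : aeval z i • v = 0
    · exact ⟨i, hi, hiv⟩
    · obtain ⟨b, hb⟩ := hv.2 _ hiv
      refine ih hp0 ?_
      rw [← hb, ← mul_smul, (commute_aeval (hz b) p).eq, mul_smul, ← mul_smul (aeval z p),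
        ← map_mul, mul_comm p i, hpv, smul_zero]

/-- An operator `D` of a finite-dimensional algebra is nilpotent if `[D, t] = E D` for some
invertible `E` commuting with `D`. -/
lemma isNilpotent_of_mul_eq_add [CharZero K] {D t E : A} (hD : IsIntegral K D) (hE : IsUnit E)
    (hDE : Commute D E) (hDt : D * t = t * D + E * D) : IsNilpotent D := by
  have hder : ∀ f : K[X], aeval D f * t = t * aeval D f + E * aeval D (X * derivative f) := by
    intro f
    induction f using Polynomial.induction_on' with
    | add f g hf hg =>
      rw [map_add, add_mul, hf, hg, derivative_add, mul_add X, map_add]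
      noncomm_ring
    | monomial k c =>
      rcases k with _ | k
      · simp [Algebra.commutes]
      · have h1 := pow_mul_of_mul_eq_add (K := K) (hDE.mul_right (Commute.refl D)) hDt k
        rw [derivative_monomial, add_tsub_cancel_right, X_mul_monomial, aeval_monomial,
          aeval_monomial, mul_assoc, h1, ← Algebra.smul_def, smul_add, ← Algebra.smul_def,
          ← Algebra.smul_def, mul_smul_comm, mul_smul_comm, ← mul_assoc,
          (hDE.pow_left k).eq, mul_assoc, ← pow_succ, smul_smul]
  let q := minpoly K D
  have hq : aeval D q = 0 := minpoly.aeval K D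
  have hXq : aeval D (X * derivative q) = 0 := by
    have h1 := hder q
    rw [hq, zero_mul, mul_zero, zero_add] at h1
    exact hE.mul_right_eq_zero.1 h1.symm
  have hcoeff : ∀ j : ℕ, (X * derivative q - C (q.natDegree : K) * q).coeff j =
      ((j : K) - q.natDegree) * q.coeff j := by
    intro j
    rcases j with _ | j
    · simp
    · rw [coeff_sub, coeff_X_mul, coeff_derivative, coeff_C_mul]
      push_cast
      ring
  have hzero : X * derivative q - C (q.natDegree : K) * q = 0 := by
    refine eq_zero_of_dvd_of_degree_lt (minpoly.dvd K D (p := _) (by simp [hXq, hq])) ?_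
    rw [degree_eq_natDegree (minpoly.ne_zero hD), degree_lt_iff_coeff_zero]
    intro j hj
    rw [hcoeff]
    rcases hj.eq_or_lt with hj | hj
    · rw [← hj, sub_self, zero_mul]
    · rw [coeff_eq_zero_of_natDegree_lt hj, mul_zero]
  refine ⟨q.natDegree, ?_⟩
  have hqX : q = X ^ q.natDegree := by
    ext j
    rw [coeff_X_pow]
    split_ifs with hj
    · rw [hj]
      exact minpoly.monic hD
    · have h1 := hcoeff j
      rw [hzero, coeff_zero] at h1
      exact (mul_eq_zero.1 h1.symm).resolve_left (sub_ne_zero.2 (by exact_mod_cast hj))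
  have h1 := hq
  rw [hqX, map_pow, aeval_X] at h1
  exact h1

end LeadingTerm

namespace LeadingTerm

open Polynomial

variable {K A : Type} [Field K] [Ring A] [Algebra K A]

/-- The relations satisfied by `d`, `u` and the skew-central element `h = w + (r - 1) a` of a
down-up algebra, when `γ = (r - 1) ^ 2 a`. -/
structure SkewTriple (d u h : A) (r a : K) : Prop where
  dh : d * h = r • (h * d)
  hu : h * u = r • (u * h)
  du : d * u = r • (u * d) + h - ((r - 1) * a) • 1

lemma DownUpTriple.skewTriple {d u w : A} {r γ a : K} (R : DownUpTriple d u w r γ)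
    (hγ : γ = (r - 1) ^ 2 * a) : SkewTriple d u (w + ((r - 1) * a) • 1) r a where
  dh := by
    rw [mul_add, R.dw, hγ]
    simp only [add_mul, smul_mul_assoc, one_mul, mul_smul_comm, mul_one]
    module
  hu := by
    rw [add_mul, R.wu, hγ]
    simp only [mul_add, smul_mul_assoc, one_mul, mul_smul_comm, mul_one]
    module
  du := by
    rw [R.du]
    module

lemma exists_expand_eq_of_comp_eq {r : K} {n : ℕ} (hn : 0 < n) (hr : IsPrimitiveRoot r n)
    {F : K[X]} (hF : F.comp (C r * X) = F) : ∃ p, F = expand K n p := by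
  refine ⟨contract n F, ?_⟩
  ext j
  rw [coeff_expand hn]
  split_ifs with hj
  · rw [coeff_contract hn.ne', Nat.div_mul_cancel hj]
  · have h1 := congrArg (fun f => coeff f j) hF
    simp only [comp_C_mul_X_coeff] at h1
    by_contra hne
    exact hj (hr.dvd_of_pow_eq_one j (mul_left_cancel₀ hne (h1.trans (mul_one _).symm)))

lemma comp_C_mul_X_ne_zero {s : K[X]} (hs : s ≠ 0) {c : K} (hc : c ≠ 0) :
    s.comp (C c * X) ≠ 0 := by
  intro h0
  refine hs (Polynomial.ext fun j => ?_)
  have h1 := congrArg (fun f => coeff f j) h0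
  simp only [comp_C_mul_X_coeff, coeff_zero] at h1
  simpa using (mul_eq_zero.1 h1).resolve_right (pow_ne_zero j hc)

/-- Every nonzero polynomial divides a nonzero polynomial in `X ^ n`. -/
lemma exists_mul_eq_expand {r : K} {n : ℕ} (hn : 0 < n) (hr : IsPrimitiveRoot r n) {s : K[X]}
    (hs : s ≠ 0) : ∃ s' p : K[X], p ≠ 0 ∧ s * s' = expand K n p := by
  have hr0 : r ≠ 0 := hr.ne_zero hn.ne'
  let f : ℕ → K[X] := fun i => s.comp (C (r ^ i) * X)
  have hf0 : f 0 = s := by simp [f]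
  have hfn : f n = f 0 := by simp only [f, hr.pow_eq_one, pow_zero]
  have hf : ∀ i, (f i).comp (C r * X) = f (i + 1) := by
    intro i
    simp only [f, comp_assoc, mul_comp, C_comp, X_comp, ← mul_assoc, ← C_mul, ← pow_succ]
  have hne : ∀ i, f i ≠ 0 := fun i => comp_C_mul_X_ne_zero hs (pow_ne_zero i hr0)
  have hF : (∏ i ∈ Finset.range n, f i).comp (C r * X) = ∏ i ∈ Finset.range n, f i := by
    rw [Polynomial.prod_comp, Finset.prod_congr rfl fun i _ => hf i]
    have h1 := Finset.prod_range_succ f n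
    rw [Finset.prod_range_succ', hfn] at h1
    exact mul_right_cancel₀ (hne 0) h1
  obtain ⟨p, hp⟩ := exists_expand_eq_of_comp_eq hn hr hF
  obtain ⟨k, rfl⟩ := Nat.exists_eq_succ_of_ne_zero hn.ne'
  refine ⟨∏ i ∈ Finset.range k, f (i + 1), p, ?_, ?_⟩
  · rintro rfl
    rw [map_zero] at hp
    exact Finset.prod_ne_zero_iff.2 (fun i _ => hne i) hp
  · rw [← hp, Finset.prod_range_succ', hf0, mul_comm]

/-- The pullback of an irreducible polynomial along `X ↦ X ^ n` is squarefree if it does not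
vanish at the origin. -/
lemma squarefree_expand [CharZero K] {n : ℕ} (hn : 0 < n) {P : K[X]} (hP : Irreducible P)
    (hP0 : ¬ X ∣ P) : Squarefree (expand K n P) := by
  refine Separable.squarefree ?_
  have h1 : IsCoprime (expand K n P) (expand K n (derivative P)) :=
    (isCoprime_expand hn.ne').2 hP.separable
  have h2 : IsCoprime (expand K n P) X := by
    refine (Irreducible.coprime_iff_not_dvd irreducible_X).2 (fun hX => hP0 ?_) |>.symm
    rw [X_dvd_iff] at hX ⊢
    rwa [← zero_mul n, coeff_expand_mul hn] at hX
  rw [Separable, derivative_expand]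
  refine h1.mul_right ?_
  have h3 : IsUnit (n : K[X]) := by
    rw [← C_eq_natCast]
    exact isUnit_C.2 (isUnit_iff_ne_zero.2 (Nat.cast_ne_zero.2 hn.ne'))
  exact (isCoprime_mul_unit_left_right h3 _ _).2 (h2.pow_right)

namespace SkewTriple

section Relations

variable {d u h : A} {r a : K} (R : SkewTriple d u h r a)
include R

open MulOpposite in
lemma op : SkewTriple (op u) (op d) (op h) r a where
  dh := by
    rw [← op_mul, R.hu]
    simp
  hu := by
    rw [← op_mul, R.dh]
    simp
  du := by
    rw [← op_mul, R.du]
    simp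

lemma d_pow_mul_h (k : ℕ) : d ^ k * h = r ^ k • (h * d ^ k) := by
  induction k with
  | zero => simp
  | succ k ih =>
    rw [pow_succ', mul_assoc, ih, mul_smul_comm, ← mul_assoc, R.dh, smul_mul_assoc, smul_smul,
      mul_assoc, ← pow_succ]

lemma h_mul_u_pow (k : ℕ) : h * u ^ k = r ^ k • (u ^ k * h) := by
  have := congrArg MulOpposite.unop (R.op.d_pow_mul_h k)
  simpa using this

lemma d_pow_mul_u (k : ℕ) :
    d ^ (k + 1) * u = r ^ (k + 1) • (u * d ^ (k + 1)) +
      (((k + 1 : ℕ) * r ^ k) • h + (a * (1 - r ^ (k + 1))) • 1) * d ^ k := by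
  induction k with
  | zero =>
    rw [zero_add, pow_one, R.du]
    simp only [Nat.cast_one, pow_zero, mul_one, pow_one]
    module
  | succ k ih =>
    have h1 : d * (h * d ^ k) = r • (h * d ^ (k + 1)) := by
      rw [← mul_assoc, R.dh, smul_mul_assoc, mul_assoc, ← pow_succ']
    have h2 : d * (u * d ^ (k + 1)) = r • (u * d ^ (k + 2)) + h * d ^ (k + 1) -
        ((r - 1) * a) • d ^ (k + 1) := by
      rw [← mul_assoc, R.du, sub_mul, add_mul, smul_mul_assoc, smul_mul_assoc, one_mul, mul_assoc,
        ← pow_succ']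
    rw [pow_succ' d (k + 1), mul_assoc, ih, mul_add, mul_smul_comm, h2]
    simp only [add_mul, mul_add, smul_mul_assoc, mul_smul_comm, one_mul, h1, ← pow_succ']
    push_cast
    module

lemma d_mul_u_pow (k : ℕ) :
    d * u ^ (k + 1) = r ^ (k + 1) • (u ^ (k + 1) * d) +
      u ^ k * (((k + 1 : ℕ) * r ^ k) • h + (a * (1 - r ^ (k + 1))) • 1) := by
  have := congrArg MulOpposite.unop (R.op.d_pow_mul_u k)
  simpa using this

lemma h_mul_u_pow_mul_d_pow (hr0 : r ≠ 0) (i j : ℕ) :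
    h * (u ^ i * d ^ j) = (r ^ i * (r ^ j)⁻¹) • (u ^ i * d ^ j * h) := by
  rw [mul_assoc _ _ h, R.d_pow_mul_h, ← mul_assoc, R.h_mul_u_pow, smul_mul_assoc, mul_smul_comm,
    smul_smul, mul_assoc, mul_assoc, inv_mul_cancel₀ (pow_ne_zero j hr0), mul_one]

lemma aeval_mul_monomial (hr0 : r ≠ 0) (s : K[X]) (i j : ℕ) :
    ∃ s' : K[X], aeval h s * (u ^ i * d ^ j) = u ^ i * d ^ j * aeval h s' := by
  refine ⟨s.comp (C (r ^ i * (r ^ j)⁻¹) * X), ?_⟩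
  rw [aeval_comp]
  refine (semiconjBy_aeval ?_ s).eq.symm
  rw [SemiconjBy, R.h_mul_u_pow_mul_d_pow hr0, map_mul, aeval_C, aeval_X, ← Algebra.smul_def,
    mul_smul_comm]

lemma monomial_mul_aeval (hr0 : r ≠ 0) (s : K[X]) (i j : ℕ) :
    ∃ s' : K[X], u ^ i * d ^ j * aeval h s = aeval h s' * (u ^ i * d ^ j) := by
  refine ⟨s.comp (C (r ^ i * (r ^ j)⁻¹)⁻¹ * X), ?_⟩
  rw [aeval_comp]
  refine (semiconjBy_aeval ?_ s).eq
  rw [SemiconjBy, map_mul, aeval_C, aeval_X, ← Algebra.smul_def, smul_mul_assoc,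
    R.h_mul_u_pow_mul_d_pow hr0, smul_smul, inv_mul_cancel₀, one_smul]
  exact mul_ne_zero (pow_ne_zero _ hr0) (inv_ne_zero (pow_ne_zero _ hr0))

theorem isSpanning (hr0 : r ≠ 0) (hgen : Algebra.adjoin K {d, u} = ⊤) :
    IsSpanning K h 1 fun q => u ^ q.1 * d ^ q.2 := by
  have hd : HasLead K h 1 (fun q => u ^ q.1 * d ^ q.2) d (0, 1) := by
    refine ⟨one_dvd _, ?_⟩
    rintro ⟨i, j⟩ -
    rcases i with _ | i
    · refine ⟨1, one_ne_zero, ?_⟩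
      simp [← pow_succ']
    · refine ⟨r ^ (i + 1), pow_ne_zero _ hr0, ?_⟩
      obtain ⟨s, hs⟩ := R.aeval_mul_monomial hr0
        (C ((i + 1 : ℕ) * r ^ i) * X + C (a * (1 - r ^ (i + 1)))) 0 j
      have h1 : d * (u ^ (i + 1) * d ^ j) - r ^ (i + 1) • (u ^ (i + 1) * d ^ (j + 1)) =
          u ^ i * d ^ j * aeval h s := by
        rw [pow_zero, one_mul] at hs
        rw [mul_assoc, ← hs, ← mul_assoc, R.d_mul_u_pow, add_mul, smul_mul_assoc, mul_assoc _ d,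
          ← pow_succ', add_sub_cancel_left, mul_assoc]
        simp [Algebra.smul_def]
      have h2 := mul_aeval_mem_low (K := K) (h := h) (m := fun q => u ^ q.1 * d ^ q.2) (e := 1)
        (q := (i, j)) (one_dvd _) (rank_lt_rank_zero (k := i + 1 + j + (0 + 1)) (by simp)) s
      simpa [h1] using h2
  have hu : HasLead K h 1 (fun q => u ^ q.1 * d ^ q.2) u (1, 0) := by
    refine ⟨one_dvd _, ?_⟩
    rintro ⟨i, j⟩ -
    refine ⟨1, one_ne_zero, ?_⟩
    simp [← mul_assoc, ← pow_succ']
  refine isSpanning_of_hasLead hgen (by simp) (fun s q => R.aeval_mul_monomial hr0 s q.1 q.2)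
    (fun s q => R.monomial_mul_aeval hr0 s q.1 q.2) hd hu ?_
  rintro ⟨i, j⟩ -
  simpa using (hu.pow i).mul (hd.pow j)

lemma commute_h_pow {n : ℕ} (hr : r ^ n = 1) (hgen : Algebra.adjoin K {d, u} = ⊤) (x : A) :
    Commute (h ^ n) x := by
  refine commute_of_adjoin_eq_top hgen ?_ ?_ x
  · have h1 : SemiconjBy d h (r • h) := by
      rw [SemiconjBy, R.dh, smul_mul_assoc]
    have h2 := h1.pow_right n
    rw [_root_.smul_pow, hr, one_smul] at h2
    exact h2.symm
  · have h1 : SemiconjBy u (r • h) h := by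
      rw [SemiconjBy, R.hu, mul_smul_comm]
    have h2 := h1.pow_right n
    rw [_root_.smul_pow, hr, one_smul] at h2
    exact Eq.symm h2

end Relations

end SkewTriple

end LeadingTerm

namespace LeadingTerm

open Polynomial

variable {K A : Type} [Field K] [Ring A] [Algebra K A]

lemma smul_comm_of_adjoin_eq_top {M : Type} [AddCommGroup M] [Module K M] [Module A M]
    [IsScalarTower K A M] {d u z : A} (hgen : Algebra.adjoin K {d, u} = ⊤)
    (hd : ∀ x : M, z • d • x = d • z • x) (hu : ∀ x : M, z • u • x = u • z • x) (a : A) :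
    ∀ x : M, z • a • x = a • z • x := by
  have ha : a ∈ Algebra.adjoin K {d, u} := hgen ▸ Algebra.mem_top
  induction ha using Algebra.adjoin_induction with
  | mem a ha =>
    rcases ha with rfl | rfl
    · exact hd
    · exact hu
  | algebraMap c =>
    intro x
    rw [← mul_smul, ← mul_smul, Algebra.commutes]
  | add a b _ _ ha hb =>
    intro x
    rw [add_smul, add_smul, smul_add, ha, hb]
  | mul a b _ _ ha hb =>
    intro x
    rw [mul_smul, ha, hb, mul_smul]

lemma aeval_op (y : A) (P : K[X]) :
    aeval (MulOpposite.op y) P = MulOpposite.op (aeval y P) := by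
  induction P using Polynomial.induction_on' with
  | add p q hp hq => rw [map_add, map_add, hp, hq, MulOpposite.op_add]
  | monomial k c =>
    rw [aeval_monomial, aeval_monomial, ← Algebra.smul_def, ← Algebra.smul_def,
      MulOpposite.op_smul, MulOpposite.op_pow]

lemma exists_mul_eq_mul_left {d u c : A} (hgen : Algebra.adjoin K {d, u} = ⊤)
    (hd : ∃ x, c * d = x * c) (hu : ∃ x, c * u = x * c) (a : A) : ∃ x, c * a = x * c := by
  have ha : a ∈ Algebra.adjoin K {d, u} := hgen ▸ Algebra.mem_top
  induction ha using Algebra.adjoin_induction with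
  | mem a ha =>
    rcases ha with rfl | rfl
    · exact hd
    · exact hu
  | algebraMap k => exact ⟨algebraMap K A k, (Algebra.commutes k c).symm⟩
  | add a b _ _ ha hb =>
    obtain ⟨x, hx⟩ := ha
    obtain ⟨y, hy⟩ := hb
    exact ⟨x + y, by rw [mul_add, add_mul, hx, hy]⟩
  | mul a b _ _ ha hb =>
    obtain ⟨x, hx⟩ := ha
    obtain ⟨y, hy⟩ := hb
    exact ⟨x * y, by rw [← mul_assoc, hx, mul_assoc, hy, mul_assoc]⟩

lemma exists_mul_eq_mul_right {d u c : A} (hgen : Algebra.adjoin K {d, u} = ⊤)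
    (hd : ∃ x, d * c = c * x) (hu : ∃ x, u * c = c * x) (a : A) : ∃ x, a * c = c * x := by
  have ha : a ∈ Algebra.adjoin K {d, u} := hgen ▸ Algebra.mem_top
  induction ha using Algebra.adjoin_induction with
  | mem a ha =>
    rcases ha with rfl | rfl
    · exact hd
    · exact hu
  | algebraMap k => exact ⟨algebraMap K A k, Algebra.commutes k c⟩
  | add a b _ _ ha hb =>
    obtain ⟨x, hx⟩ := ha
    obtain ⟨y, hy⟩ := hb
    exact ⟨x + y, by rw [mul_add, add_mul, hx, hy]⟩
  | mul a b _ _ ha hb =>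
    obtain ⟨x, hx⟩ := ha
    obtain ⟨y, hy⟩ := hb
    exact ⟨x * y, by rw [mul_assoc, hy, ← mul_assoc, hx, mul_assoc]⟩

theorem IsSpanning.isArtinian_of_aeval_smul_eq_zero {h : A} {e : ℕ} {m : ℕ × ℕ → A}
    (H : IsSpanning K h e m) (he : 0 < e) {P : K[X]} (hP : Squarefree P)
    (hcen : ∀ a, Commute (aeval h P) a) {k₀ : ℕ}
    (hfd : ∀ (Q : Type) [AddCommGroup Q] [Module A Q] [Module K Q] [IsScalarTower K A Q]
      [FiniteDimensional K Q], (∀ x : Q, aeval h P • x = 0) → ∀ q : ℕ × ℕ, e ∣ q.1 + q.2 →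
        k₀ ≤ q.1 + q.2 → ∀ x : Q, m q • x = 0)
    {M : Type} [AddCommGroup M] [Module A M] [Module.Finite A M] {v : M} (hv : InMonolith A v)
    (hPv : aeval h P • v = 0) : IsArtinian A M := by
  have := H.isNoetherianRing
  have : IsNoetherian A M := isNoetherian_of_isNoetherianRing_of_finite A M
  refine isArtinian_of_normal (c := aeval h P) (fun a => ⟨a, hcen a⟩)
    (fun a => ⟨a, (hcen a).symm⟩) hv hPv fun N hN hvN => ?_
  exact H.isArtinian_of_squarefree he hP hcen hfd (hv.subtype hvN)
    fun x => Subtype.ext (hN x.1 x.2)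

lemma isUnit_of_aeval_eq_zero {h : A} {P : K[X]} (hP : P.coeff 0 ≠ 0) (hPh : aeval h P = 0) :
    IsUnit h := by
  have h1 : h * ((-(P.coeff 0)⁻¹) • aeval h P.divX) = 1 := by
    have h2 := hPh
    rw [← X_mul_divX_add P, map_add, map_mul, aeval_X, aeval_C, add_eq_zero_iff_eq_neg] at h2
    rw [mul_smul_comm, h2, smul_neg, neg_smul, neg_neg, Algebra.smul_def, ← map_mul,
      inv_mul_cancel₀ hP, map_one]
  have h3 : Commute h ((-(P.coeff 0)⁻¹) • aeval h P.divX) :=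
    ((commute_aeval (Commute.refl h) _).symm).smul_right _
  exact ⟨⟨h, _, h1, h3.eq ▸ h1⟩, rfl⟩

lemma eval_eq_zero_of_mul_eq_smul {h x : A} {μ : K} (hx : x ≠ 0) (hhx : h * x = μ • x) {P : K[X]}
    (hP : aeval h P = 0) : P.IsRoot μ := by
  have h1 : aeval h P * x = P.eval μ • x := by
    clear hP
    induction P using Polynomial.induction_on' with
    | add p q hp hq => rw [map_add, add_mul, hp, hq, eval_add, add_smul]
    | monomial k c =>
      have h2 : h ^ k * x = μ ^ k • x := by
        induction k with
        | zero => simp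
        | succ k ih => rw [pow_succ, mul_assoc, hhx, mul_smul_comm, ih, smul_smul, pow_succ']
      rw [aeval_monomial, mul_assoc, h2, ← Algebra.smul_def, smul_smul, eval_monomial]
  rw [hP, zero_mul] at h1
  by_contra hne
  exact hx ((smul_eq_zero.1 h1.symm).resolve_left hne)

namespace SkewTriple

lemma map {B : Type} [Ring B] [Algebra K B] {d u h : A} {r a : K} (R : SkewTriple d u h r a)
    (f : A →ₐ[K] B) : SkewTriple (f d) (f u) (f h) r a where
  dh := by rw [← map_mul, R.dh, map_smul, map_mul]
  hu := by rw [← map_mul, R.hu, map_smul, map_mul]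
  du := by simp only [← map_mul, R.du, map_sub, map_add, map_smul, map_one]

lemma isNilpotent_d [CharZero K] {d u h : A} {r a : K} (R : SkewTriple d u h r a)
    [FiniteDimensional K A] {n : ℕ} (hn : 0 < n) (hr : r ^ n = 1) (hh : IsUnit h) :
    IsNilpotent d := by
  have hr0 : r ≠ 0 := by
    rintro rfl
    simp [hn.ne'] at hr
  obtain ⟨k, rfl⟩ := Nat.exists_eq_succ_of_ne_zero hn.ne'
  rw [Nat.succ_eq_add_one] at hr
  have h1 := R.d_pow_mul_u k
  rw [hr, one_smul, sub_self, mul_zero, zero_smul, add_zero] at h1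
  have h2 : Commute (d ^ (k + 1)) h := by
    have := R.d_pow_mul_h (k + 1)
    rwa [hr, one_smul] at this
  have hc : ((k + 1 : ℕ) : K) * r ^ k ≠ 0 :=
    mul_ne_zero (Nat.cast_ne_zero.2 k.succ_ne_zero) (pow_ne_zero k hr0)
  have h3 : IsUnit ((((k + 1 : ℕ) : K) * r ^ k) • h) := by
    rw [Algebra.smul_def]
    exact ((isUnit_iff_ne_zero.2 hc).map (algebraMap K A)).mul hh
  have h4 := isNilpotent_of_mul_eq_add (K := K) (D := d ^ (k + 1)) (t := u * d)
    (IsIntegral.of_finite K _) h3 (h2.smul_right _) (by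
      rw [← mul_assoc, h1, add_mul, mul_assoc, mul_assoc, mul_assoc, ← pow_succ, ← pow_succ, ← pow_succ'])
  exact h4.of_pow

/-- On the finite-dimensional modules killed by a polynomial in `h` with nonzero constant term,
`d` is nilpotent of bounded index. -/
lemma exists_pow_eq_zero [CharZero K] {n : ℕ} (hn : 0 < n) {r : K} (hr : r ^ n = 1) (a : K)
    {P : K[X]} (hP : P.coeff 0 ≠ 0) :
    ∃ k₀ : ℕ, ∀ (B : Type) [Ring B] [Algebra K B] [FiniteDimensional K B] (d u h : B),
      SkewTriple d u h r a → aeval h P = 0 → d ^ k₀ = 0 := by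
  have hr0 : r ≠ 0 := by
    rintro rfl
    simp [hn.ne'] at hr
  have hP0 : P ≠ 0 := by
    rintro rfl
    simp at hP
  have hfin : {k : ℕ | ∃ μ : K, P.IsRoot μ ∧
      (k + 1 : ℕ) * r ^ k * μ = a * (r ^ (k + 1) - 1)}.Finite := by
    refine Set.Finite.subset (((finite_setOfPred_isRoot hP0).image2
      (fun μ t : K => a * (t - 1) * r / (t * μ))
      (finite_setOfPred_isRoot (X_pow_sub_C_ne_zero hn (1 : K)))).preimage
      (f := fun k : ℕ => ((k + 1 : ℕ) : K))
      fun k _ l _ hkl => Nat.succ_injective (Nat.cast_injective hkl)) ?_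
    rintro k ⟨μ, hμ, hk⟩
    have hμ0 : μ ≠ 0 := by
      rintro rfl
      rw [IsRoot.def, ← coeff_zero_eq_eval_zero] at hμ
      exact hP hμ
    refine ⟨μ, hμ, r ^ (k + 1), ?_, ?_⟩
    · simp [← pow_mul, mul_comm _ n, pow_mul r n, hr]
    · simp only
      rw [← hk]
      field_simp
      ring
  obtain ⟨k₁, hk₁⟩ := hfin.bddAbove
  refine ⟨k₁ + 1, fun B _ _ _ d u h R hPh => ?_⟩
  have hnil : ∃ k, d ^ k = 0 := R.isNilpotent_d hn hr (isUnit_of_aeval_eq_zero hP hPh)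
  classical
  rcases hm : Nat.find hnil with _ | k
  · have h1 := Nat.find_spec hnil
    rw [hm, pow_zero] at h1
    rw [← mul_one (d ^ _), h1, mul_zero]
  · have h1 := Nat.find_spec hnil
    rw [hm] at h1
    have h2 : d ^ k ≠ 0 := Nat.find_min hnil (by omega)
    have h3 := R.d_pow_mul_u k
    rw [h1, zero_mul, mul_zero, smul_zero, zero_add, add_mul, smul_mul_assoc, smul_mul_assoc,
      one_mul] at h3
    have hc : ((k + 1 : ℕ) : K) * r ^ k ≠ 0 :=
      mul_ne_zero (Nat.cast_ne_zero.2 k.succ_ne_zero) (pow_ne_zero k hr0)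
    have h4 : h * d ^ k = ((((k + 1 : ℕ) : K) * r ^ k)⁻¹ * (a * (r ^ (k + 1) - 1))) • d ^ k := by
      rw [mul_smul, eq_inv_smul_iff₀ hc, ← sub_eq_zero, h3]
      module
    have h5 : k ≤ k₁ := hk₁ ⟨_, eval_eq_zero_of_mul_eq_smul h2 h4 hPh, mul_inv_cancel_left₀ hc _⟩
    exact pow_eq_zero_of_le (by omega) h1

end SkewTriple

theorem DownUpTriple.isArtinian_of_skew [CharZero K] {d u w : A} {r γ a : K}
    (R : DownUpTriple d u w r γ) (hγ : γ = (r - 1) ^ 2 * a) {n : ℕ} (hn : 0 < n)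
    (hr : IsPrimitiveRoot r n) (hgen : Algebra.adjoin K {d, u} = ⊤)
    {M : Type} [AddCommGroup M] [Module K M] [Module A M] [IsScalarTower K A M]
    [Module.Finite A M] {v : M} (hv : InMonolith A v) : IsArtinian A M := by
  have hr0 : r ≠ 0 := hr.ne_zero hn.ne'
  have S := R.skewTriple hγ
  set h := w + ((r - 1) * a) • 1 with hh
  have H := S.isSpanning hr0 hgen
  have hcen := S.commute_h_pow hr.pow_eq_one hgen
  have := H.isNoetherianRing
  have : IsNoetherian A M := isNoetherian_of_isNoetherianRing_of_finite A M
  obtain ⟨p, hp0, hpv⟩ := H.exists_aeval_smul_eq_zero hn hcen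
    (fun s hs => exists_mul_eq_expand hn hr hs) hv
  obtain ⟨P, hP, hPv⟩ := hv.exists_irreducible hcen hp0 hpv
  by_cases hX : X ∣ P
  · obtain ⟨b, hb⟩ := (irreducible_X.associated_of_dvd hP hX).symm.dvd
    have hnil : ∃ k, h ^ k • v = 0 := by
      refine ⟨n, ?_⟩
      rw [← aeval_X (R := K) (h ^ n), hb, mul_comm, map_mul, mul_smul, hPv, smul_zero]
    classical
    rcases hm : Nat.find hnil with _ | k
    · have h1 := Nat.find_spec hnil
      rw [hm, pow_zero, one_smul] at h1
      exact absurd h1 hv.1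
    have h1 := Nat.find_spec hnil
    rw [hm, pow_succ', mul_smul] at h1
    have hv' := hv.smul (Nat.find_min hnil (m := k) (by omega))
    refine isArtinian_of_normal (c := h) ?_ ?_ hv' h1 fun N hN hvN => ?_
    · refine exists_mul_eq_mul_left hgen ⟨r⁻¹ • d, ?_⟩ ⟨r • u, ?_⟩
      · rw [smul_mul_assoc, S.dh, smul_smul, inv_mul_cancel₀ hr0, one_smul]
      · rw [S.hu, smul_mul_assoc]
    · refine exists_mul_eq_mul_right hgen ⟨r • d, ?_⟩ ⟨r⁻¹ • u, ?_⟩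
      · rw [S.dh, mul_smul_comm]
      · rw [mul_smul_comm, S.hu, smul_smul, inv_mul_cancel₀ hr0, one_smul]
    have hN' : ∀ x : N, h • x = 0 := fun x => Subtype.ext (hN x.1 x.2)
    obtain ⟨l, rfl⟩ := Nat.exists_eq_succ_of_ne_zero hn.ne'
    have hl : r ^ (l + 1) = 1 := hr.pow_eq_one
    refine R.isArtinian_of_central hr0 hgen (N := l + 1) l.succ_pos (smul_comm_of_adjoin_eq_top hgen ?_ ?_)
      (smul_comm_of_adjoin_eq_top hgen ?_ ?_) (monic_X_add_C ((r - 1) * a))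
      (by rw [natDegree_X_add_C]; exact one_ne_zero) ?_ (hv'.subtype hvN)
    · intro x
      rw [← mul_smul, ← mul_smul, ← pow_succ, ← pow_succ']
    · intro x
      rw [← mul_smul, S.d_pow_mul_u, hl, one_smul, sub_self, mul_zero, zero_smul, add_zero,
        add_smul, mul_smul, mul_smul _ (d ^ l), smul_assoc, hN', smul_zero, add_zero]
    · intro x
      rw [← mul_smul d, S.d_mul_u_pow, hl, one_smul, sub_self, mul_zero, zero_smul, add_zero,
        add_smul, mul_smul, mul_smul (u ^ l), smul_assoc, hN', smul_zero, smul_zero, add_zero]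
    · intro x
      rw [← mul_smul, ← mul_smul, ← pow_succ, ← pow_succ']
    · intro b x
      have h2 : aeval w (X + C ((r - 1) * a)) = h := by
        rw [map_add, aeval_X, aeval_C, Algebra.algebraMap_eq_smul_one]
      rw [h2, hN', hN', smul_zero]
  · have hP0 : (expand K n P).coeff 0 ≠ 0 := by
      rw [← zero_mul n, coeff_expand_mul hn]
      rwa [X_dvd_iff] at hX
    obtain ⟨k₀, hk₀⟩ := SkewTriple.exists_pow_eq_zero hn hr.pow_eq_one a hP0
    refine H.isArtinian_of_aeval_smul_eq_zero one_pos (squarefree_expand hn hP hX)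
      (k₀ := 2 * k₀) (fun b => ?_) ?_ hv (by rwa [expand_aeval])
    · rw [expand_aeval]
      exact commute_aeval (hcen b) P
    · intro Q _ _ _ _ _ hPQ q _ hq x
      let ρ : A →ₐ[K] Module.End K Q := Algebra.lsmul K K Q
      have hρ : aeval (ρ h) (expand K n P) = 0 := by
        rw [aeval_algHom_apply]
        exact LinearMap.ext hPQ
      have hd := hk₀ _ _ _ _ (S.map ρ) hρ
      have : FiniteDimensional K (Module.End K Q)ᵐᵒᵖ :=
        Module.Finite.equiv (MulOpposite.opLinearEquiv K)
      have hu := hk₀ _ _ _ _ (S.map ρ).op (by rw [aeval_op, hρ, MulOpposite.op_zero])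
      rw [← MulOpposite.op_pow, MulOpposite.op_eq_zero_iff] at hu
      rw [← map_pow] at hd hu
      have hq' : k₀ ≤ q.1 ∨ k₀ ≤ q.2 := by omega
      suffices ρ (u ^ q.1 * d ^ q.2) = 0 from LinearMap.congr_fun this x
      rcases hq' with hq' | hq'
      · rw [← Nat.add_sub_cancel' hq', pow_add, map_mul, map_mul, hu, zero_mul, zero_mul]
      · rw [← Nat.sub_add_cancel hq', pow_add, map_mul, map_mul, hd, mul_zero, mul_zero]

end LeadingTerm

namespace LeadingTerm

open Polynomial

variable {K A : Type} [Field K] [Ring A] [Algebra K A]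

/-- The Casimir element of a down-up algebra with `r = 1`. -/
def casimir (d u w : A) (γ : K) : A := (2 * γ) • (u * d) - w * w + γ • w

/-- A basis over the polynomials in the Casimir element, indexed by the pairs of even degree. -/
def casimirMonomial (d u w : A) (q : ℕ × ℕ) : A := u ^ (q.1 / 2) * w ^ (q.1 % 2) * d ^ (q.2 / 2)

lemma casimirMonomial_even (d u w : A) (i j : ℕ) :
    casimirMonomial d u w (2 * i, 2 * j) = u ^ i * d ^ j := by
  simp [casimirMonomial]

lemma casimirMonomial_odd (d u w : A) (i j : ℕ) :
    casimirMonomial d u w (2 * i + 1, 2 * j + 1) = u ^ i * w * d ^ j := by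
  have h1 : (2 * i + 1) / 2 = i := by omega
  have h2 : (2 * j + 1) / 2 = j := by omega
  have h3 : (2 * i + 1) % 2 = 1 := by omega
  simp only [casimirMonomial, h1, h2, h3, pow_one]

lemma exists_eq_of_two_dvd {q : ℕ × ℕ} (hq : 2 ∣ q.1 + q.2) :
    (∃ i j, q = (2 * i, 2 * j)) ∨ ∃ i j, q = (2 * i + 1, 2 * j + 1) := by
  rcases q with ⟨a, b⟩
  simp only [Prod.mk.injEq] at hq ⊢
  rcases Nat.even_or_odd' a with ⟨i, rfl | rfl⟩
  · exact Or.inl ⟨i, b / 2, rfl, by omega⟩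
  · exact Or.inr ⟨i, b / 2, rfl, by omega⟩

lemma mul_aeval_mem_low_even {d u w h : A} {i j k : ℕ} (hk : 2 * i + 2 * j < k) (s : K[X]) :
    u ^ i * d ^ j * aeval h s ∈ low (K := K) h 2 (casimirMonomial d u w) (rank (0, k)) := by
  rw [← casimirMonomial_even d u w]
  exact mul_aeval_mem_low (by simp only; omega) (rank_lt_rank_zero hk) s

lemma mem_low_even {d u w h : A} {i j k : ℕ} (hk : 2 * i + 2 * j < k) :
    u ^ i * d ^ j ∈ low (K := K) h 2 (casimirMonomial d u w) (rank (0, k)) := by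
  simpa using mul_aeval_mem_low_even (K := K) (h := h) (w := w) hk 1

lemma mem_low_odd {d u w h : A} {i j k : ℕ} (hk : 2 * i + 1 + (2 * j + 1) < k) :
    u ^ i * w * d ^ j ∈ low (K := K) h 2 (casimirMonomial d u w) (rank (0, k)) := by
  have := mul_aeval_mem_low (K := K) (h := h) (m := casimirMonomial d u w) (e := 2)
    (q := (2 * i + 1, 2 * j + 1)) (by simp only; omega) (rank_lt_rank_zero hk) 1
  rwa [casimirMonomial_odd, map_one, mul_one] at this

lemma hasLead_u (d u w : A) (γ : K) :
    HasLead K (casimir d u w γ) 2 (casimirMonomial d u w) u (2, 0) := by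
  refine ⟨by simp, fun q hq => ⟨1, one_ne_zero, ?_⟩⟩
  have h1 : (q.1 + 2) / 2 = q.1 / 2 + 1 := by omega
  simp [casimirMonomial, h1, pow_succ', mul_assoc]

lemma w_mul_w (d u w : A) (γ : K) :
    w * w = (2 * γ) • (u * d) + γ • w - casimir d u w γ := by
  rw [casimir]
  abel

namespace DownUpTriple

lemma map {B : Type} [Ring B] [Algebra K B] {d u w : A} {r γ : K} (R : DownUpTriple d u w r γ)
    (f : A →ₐ[K] B) : DownUpTriple (f d) (f u) (f w) r γ where
  dw := by simp only [← map_mul, R.dw, ← map_smul, ← map_add, ← map_one f]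
  wu := by simp only [← map_mul, R.wu, ← map_smul, ← map_add, ← map_one f]
  du := by rw [← map_mul, R.du, map_add, map_smul, map_mul]

section Casimir

variable {d u w : A} {γ : K} (R : DownUpTriple d u w 1 γ)
include R

lemma commute_casimir_d : Commute (casimir d u w γ) d := by
  have h1 : d * w = w * d + γ • d := by
    simpa [add_mul] using R.dw
  have h2 : d * u = u * d + w := by
    simpa using R.du
  have h3 : d * (w * w) = w * w * d + (2 * γ) • (w * d) + (γ * γ) • d := by
    rw [← mul_assoc, h1, add_mul, mul_assoc, h1, smul_mul_assoc, h1, mul_add, ← mul_assoc,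
      mul_smul_comm]
    module
  symm
  rw [commute_iff_eq, casimir, mul_add, mul_sub, mul_smul_comm, mul_smul_comm, h3, h1, add_mul,
    sub_mul, smul_mul_assoc, smul_mul_assoc, ← mul_assoc, h2, add_mul]
  module

lemma commute_casimir_u : Commute (casimir d u w γ) u := by
  have h1 := R.op.commute_casimir_d
  have h2 : casimir (MulOpposite.op u) (MulOpposite.op d) (MulOpposite.op w) γ =
      MulOpposite.op (casimir d u w γ) := by
    simp [casimir]
  rw [h2] at h1
  exact MulOpposite.op_injective (by simpa using h1.eq.symm)

lemma mul_w_mul_w_mul (i j : ℕ) : u ^ i * w * w * d ^ j =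
    (2 * γ) • (u ^ (i + 1) * d ^ (j + 1)) + γ • (u ^ i * w * d ^ j) -
      u ^ i * d ^ j * aeval (casimir d u w γ) (X : K[X]) := by
  rw [aeval_X, mul_assoc _ _ (casimir d u w γ), ← (R.commute_casimir_d.pow_right j).eq,
    mul_assoc (u ^ i), w_mul_w d u w γ, pow_succ u, pow_succ' d]
  simp only [mul_add, mul_sub, add_mul, sub_mul, mul_smul_comm, smul_mul_assoc, mul_assoc]

lemma hasLead_w (hγ : (2 * γ) ≠ 0) :
    HasLead K (casimir d u w γ) 2 (casimirMonomial d u w) w (1, 1) := by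
  refine ⟨by simp, fun q hq => ?_⟩
  rcases exists_eq_of_two_dvd hq with ⟨i, j, rfl⟩ | ⟨i, j, rfl⟩
  · refine ⟨1, one_ne_zero, ?_⟩
    have h1 := R.w_mul_u_pow i
    rw [one_pow, one_smul, mul_add, mul_smul_comm, mul_one] at h1
    rw [Prod.mk_add_mk, casimirMonomial_even, casimirMonomial_odd, ← mul_assoc, h1, add_mul,
      one_smul, add_sub_cancel_left, smul_mul_assoc]
    exact Submodule.smul_mem _ _ (mem_low_even (by simp only; omega))
  · refine ⟨2 * γ, hγ, ?_⟩
    have h1 := R.w_mul_u_pow i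
    rw [one_pow, one_smul, mul_add, mul_smul_comm, mul_one] at h1
    have h2 : ((2 * i + 1, 2 * j + 1) + (1, 1) : ℕ × ℕ) = (2 * (i + 1), 2 * (j + 1)) := by
      simp only [Prod.mk_add_mk, Prod.mk.injEq]
      omega
    have h3 : w * (u ^ i * w * d ^ j) - (2 * γ) • (u ^ (i + 1) * d ^ (j + 1)) =
        γ • (u ^ i * w * d ^ j) - u ^ i * d ^ j * aeval (casimir d u w γ) (X : K[X]) +
          (γ * ∑ i ∈ Finset.range i, 1 ^ i) • (u ^ i * w * d ^ j) := by
      rw [← mul_assoc, ← mul_assoc, h1, add_mul, add_mul, R.mul_w_mul_w_mul, smul_mul_assoc,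
        smul_mul_assoc]
      abel
    rw [h2, casimirMonomial_even, casimirMonomial_odd, h3]
    exact add_mem (sub_mem (Submodule.smul_mem _ _ (mem_low_odd (by simp only; omega)))
      (mul_aeval_mem_low_even (by simp only; omega) _))
      (Submodule.smul_mem _ _ (mem_low_odd (by simp only; omega)))

lemma hasLead_d : HasLead K (casimir d u w γ) 2 (casimirMonomial d u w) d (0, 2) := by
  have hw : d * w = w * d + γ • d := by
    simpa [add_mul] using R.dw
  refine ⟨by simp, fun q hq => ⟨1, one_ne_zero, ?_⟩⟩
  rcases exists_eq_of_two_dvd hq with ⟨i, j, rfl⟩ | ⟨i, j, rfl⟩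
  · have h2 : ((2 * i, 2 * j) + (0, 2) : ℕ × ℕ) = (2 * i, 2 * (j + 1)) := by
      simp only [Prod.mk_add_mk, Prod.mk.injEq]
      omega
    rw [h2, casimirMonomial_even, casimirMonomial_even, one_smul]
    rcases i with _ | i
    · simp [pow_succ']
    · have h3 : d * (u ^ (i + 1) * d ^ j) - u ^ (i + 1) * d ^ (j + 1) =
          ((i + 1 : ℕ) * 1 ^ i : K) • (u ^ i * w * d ^ j) +
            (γ * ∑ j ∈ Finset.range i, ((j + 1 : ℕ) : K) * 1 ^ j) • (u ^ i * d ^ j) := by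
        rw [← mul_assoc, R.d_mul_u_pow, one_pow, one_smul, add_mul, mul_assoc _ d, ← pow_succ',
          add_sub_cancel_left, mul_add, mul_smul_comm, mul_smul_comm, mul_one, add_mul,
          smul_mul_assoc, smul_mul_assoc]
      rw [h3]
      exact add_mem (Submodule.smul_mem _ _ (mem_low_odd (by simp only; omega)))
        (Submodule.smul_mem _ _ (mem_low_even (by simp only; omega)))
  · have h2 : ((2 * i + 1, 2 * j + 1) + (0, 2) : ℕ × ℕ) = (2 * i + 1, 2 * (j + 1) + 1) :=
      rfl
    have h3 : ∀ k, u ^ k * d * w * d ^ j = u ^ k * w * d ^ (j + 1) + γ • (u ^ k * d ^ (j + 1)) := by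
      intro k
      rw [mul_assoc _ d, hw, pow_succ']
      simp only [mul_add, add_mul, mul_smul_comm, smul_mul_assoc, mul_assoc]
    rw [h2, casimirMonomial_odd, casimirMonomial_odd, one_smul]
    rcases i with _ | i
    · have h4 := h3 0
      rw [pow_zero, one_mul, one_mul, one_mul] at h4
      rw [pow_zero, one_mul, ← mul_assoc, h4, add_sub_cancel_left]
      refine Submodule.smul_mem _ _ ?_
      have h5 := mem_low_even (K := K) (d := d) (u := u) (w := w) (h := casimir d u w γ)
        (i := 0) (j := j + 1) (k := 2 * 0 + 1 + (2 * j + 1) + (0 + 2)) (by omega)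
      rwa [pow_zero, one_mul] at h5
    · have h4 : d * (u ^ (i + 1) * w * d ^ j) - u ^ (i + 1) * w * d ^ (j + 1) =
          γ • (u ^ (i + 1) * d ^ (j + 1)) + (((i + 1 : ℕ) * 1 ^ i : K) • (u ^ i * w * w * d ^ j) +
            (γ * ∑ j ∈ Finset.range i, ((j + 1 : ℕ) : K) * 1 ^ j) • (u ^ i * w * d ^ j)) := by
        rw [← mul_assoc, ← mul_assoc, R.d_mul_u_pow, one_pow, one_smul, add_mul, add_mul, h3,
          add_assoc, add_sub_cancel_left, mul_add, mul_smul_comm, mul_smul_comm, mul_one, add_mul,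
          add_mul, smul_mul_assoc, smul_mul_assoc, smul_mul_assoc, smul_mul_assoc]
      rw [h4, R.mul_w_mul_w_mul]
      refine add_mem (Submodule.smul_mem _ _ (mem_low_even (by simp only; omega)))
        (add_mem (Submodule.smul_mem _ _ (sub_mem (add_mem (Submodule.smul_mem _ _ ?_)
          (Submodule.smul_mem _ _ ?_)) ?_)) (Submodule.smul_mem _ _ ?_))
      · exact mem_low_even (by simp only; omega)
      · exact mem_low_odd (by simp only; omega)
      · exact mul_aeval_mem_low_even (by simp only; omega) _
      · exact mem_low_odd (by simp only; omega)

theorem isSpanning_casimir (hγ : (2 * γ) ≠ 0) (hgen : Algebra.adjoin K {d, u} = ⊤) :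
    IsSpanning K (casimir d u w γ) 2 (casimirMonomial d u w) := by
  have hcen := commute_of_adjoin_eq_top hgen R.commute_casimir_d R.commute_casimir_u
  refine isSpanning_of_hasLead hgen (by simp [casimirMonomial])
    (fun s q => ⟨s, (commute_aeval (hcen _) s).eq⟩)
    (fun s q => ⟨s, (commute_aeval (hcen _) s).eq.symm⟩) R.hasLead_d
    (hasLead_u d u w γ) fun q hq => ?_
  rcases exists_eq_of_two_dvd hq with ⟨i, j, rfl⟩ | ⟨i, j, rfl⟩
  · rw [casimirMonomial_even]
    simpa [mul_comm] using ((hasLead_u d u w γ).pow i).mul (R.hasLead_d.pow j)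
  · rw [casimirMonomial_odd]
    simpa [mul_comm, add_comm] using
      (((hasLead_u d u w γ).pow i).mul (R.hasLead_w hγ)).mul (R.hasLead_d.pow j)

lemma isNilpotent_d [CharZero K] [FiniteDimensional K A] (hγ : γ ≠ 0) : IsNilpotent d := by
  refine isNilpotent_of_mul_eq_add (K := K) (t := w) (E := γ • 1) (IsIntegral.of_finite K _) ?_
    ((Commute.one_right d).smul_right γ) ?_
  · rw [← Algebra.algebraMap_eq_smul_one]
    exact (isUnit_iff_ne_zero.2 hγ).map (algebraMap K A)
  · simpa [add_mul] using R.dw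

lemma casimir_mul_d_pow [CharZero K] {k : ℕ} (hk : d ^ (k + 1) = 0) :
    casimir d u w γ * d ^ k = (-(γ ^ 2 * (k * (k + 2) : ℕ) / 4)) • d ^ k := by
  have hT : ∀ k : ℕ, ∑ j ∈ Finset.range k, ((j + 1 : ℕ) : K) * 1 ^ j = k * (k + 1) / 2 := by
    intro k
    induction k with
    | zero => simp
    | succ k ih =>
      rw [Finset.sum_range_succ, ih]
      push_cast
      field_simp
      ring
  have h1 := R.d_pow_mul_u k
  rw [hk, zero_mul, mul_zero, smul_zero, zero_add, add_mul, smul_mul_assoc, smul_mul_assoc,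
    one_mul, hT, one_pow, mul_one] at h1
  have hk0 : ((k + 1 : ℕ) : K) ≠ 0 := Nat.cast_ne_zero.2 k.succ_ne_zero
  have h2 : w * d ^ k = (-(γ * k / 2)) • d ^ k := by
    refine (smul_right_injective A hk0) ?_
    simp only
    rw [← sub_eq_zero, h1]
    push_cast
    module
  rw [casimir, add_mul, sub_mul, smul_mul_assoc, mul_assoc, ← pow_succ', hk, mul_zero, smul_zero,
    zero_sub, mul_assoc, h2, mul_smul_comm, smul_mul_assoc, h2]
  push_cast
  module

end Casimir

lemma exists_pow_eq_zero [CharZero K] {γ : K} (hγ : γ ≠ 0) {P : K[X]} (hP : P ≠ 0) :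
    ∃ k₀ : ℕ, ∀ (B : Type) [Ring B] [Algebra K B] [FiniteDimensional K B] (d u w : B),
      DownUpTriple d u w 1 γ → aeval (casimir d u w γ) P = 0 → d ^ k₀ = 0 := by
  have hinj : Function.Injective fun k : ℕ => -(γ ^ 2 * (k * (k + 2) : ℕ) / 4) := by
    intro k l hkl
    simp only [neg_inj] at hkl
    have h1 : ((k * (k + 2) : ℕ) : K) = (l * (l + 2) : ℕ) :=
      mul_left_cancel₀ (pow_ne_zero 2 hγ) ((div_left_inj' (by norm_num : (4 : K) ≠ 0)).1 hkl)
    have h2 : k * (k + 2) = l * (l + 2) := Nat.cast_injective h1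
    rcases lt_trichotomy k l with h | h | h
    · nlinarith
    · exact h
    · nlinarith
  obtain ⟨k₁, hk₁⟩ := ((finite_setOfPred_isRoot hP).preimage hinj.injOn).bddAbove
  refine ⟨k₁ + 1, fun B _ _ _ d u w R hPh => ?_⟩
  have hnil : ∃ k, d ^ k = 0 := R.isNilpotent_d hγ
  classical
  rcases hm : Nat.find hnil with _ | k
  · have h1 := Nat.find_spec hnil
    rw [hm, pow_zero] at h1
    rw [← mul_one (d ^ _), h1, mul_zero]
  · have h1 := Nat.find_spec hnil
    rw [hm] at h1
    have h2 : d ^ k ≠ 0 := Nat.find_min hnil (by omega)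
    have h3 : k ≤ k₁ := hk₁ (eval_eq_zero_of_mul_eq_smul h2 (R.casimir_mul_d_pow h1) hPh)
    exact pow_eq_zero_of_le (by omega) h1

theorem isArtinian_of_casimir [CharZero K] {d u w : A} {γ : K} (R : DownUpTriple d u w 1 γ)
    (hγ : γ ≠ 0) (hgen : Algebra.adjoin K {d, u} = ⊤) {M : Type} [AddCommGroup M] [Module A M]
    [Module.Finite A M] {v : M} (hv : InMonolith A v) : IsArtinian A M := by
  have H := R.isSpanning_casimir (mul_ne_zero two_ne_zero hγ) hgen
  have hcen := commute_of_adjoin_eq_top hgen R.commute_casimir_d R.commute_casimir_u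
  obtain ⟨p, hp0, hpv⟩ := H.exists_aeval_smul_eq_zero one_pos (by simpa using hcen)
    (fun s hs => ⟨1, s, hs, by simp⟩) hv
  rw [pow_one] at hpv
  obtain ⟨P, hP, hPv⟩ := hv.exists_irreducible hcen hp0 hpv
  obtain ⟨k₀, hk₀⟩ := exists_pow_eq_zero hγ hP.ne_zero
  refine H.isArtinian_of_aeval_smul_eq_zero two_pos hP.squarefree (k₀ := 4 * k₀ + 2)
    (fun b => commute_aeval (hcen b) P) ?_ hv hPv
  intro Q _ _ _ _ _ hPQ q hq2 hq x
  let ρ : A →ₐ[K] Module.End K Q := Algebra.lsmul K K Q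
  have hcas : casimir (ρ d) (ρ u) (ρ w) γ = ρ (casimir d u w γ) := by
    simp [casimir]
  have hρ : aeval (ρ (casimir d u w γ)) P = 0 := by
    rw [aeval_algHom_apply]
    exact LinearMap.ext hPQ
  have hd := hk₀ _ _ _ _ (R.map ρ) (by rw [hcas, hρ])
  have : FiniteDimensional K (Module.End K Q)ᵐᵒᵖ :=
    Module.Finite.equiv (MulOpposite.opLinearEquiv K)
  have hu := hk₀ _ _ _ _ (R.map ρ).op (by
    have h1 : casimir (MulOpposite.op (ρ u)) (MulOpposite.op (ρ d)) (MulOpposite.op (ρ w)) γ =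
        MulOpposite.op (casimir (ρ d) (ρ u) (ρ w) γ) := by
      simp [casimir]
    rw [h1, aeval_op, hcas, hρ, MulOpposite.op_zero])
  rw [← MulOpposite.op_pow, MulOpposite.op_eq_zero_iff] at hu
  rw [← map_pow] at hd hu
  have hq' : k₀ ≤ q.1 / 2 ∨ k₀ ≤ q.2 / 2 := by omega
  suffices ρ (casimirMonomial d u w q) = 0 from LinearMap.congr_fun this x
  rw [casimirMonomial, map_mul, map_mul]
  rcases hq' with hq' | hq'
  · rw [← Nat.add_sub_cancel' hq', pow_add, map_mul, hu, zero_mul, zero_mul, zero_mul]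
  · rw [← Nat.sub_add_cancel hq', pow_add, map_mul, hd, mul_zero, mul_zero]

end DownUpTriple

end LeadingTerm

namespace LeadingTerm

open Polynomial

variable {K A : Type} [Field K] [Ring A] [Algebra K A]

lemma downUpTriple_of_rel {d u : A} {r γ : K}
    (h1 : d * d * u = (2 * r) • (d * u * d) + (-(r ^ 2)) • (u * d * d) + γ • d)
    (h2 : d * u * u = (2 * r) • (u * d * u) + (-(r ^ 2)) • (u * u * d) + γ • u) :
    DownUpTriple d u (d * u - r • (u * d)) r γ where
  dw := by
    rw [mul_sub, ← mul_assoc, h1]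
    simp only [smul_sub, add_mul, sub_mul, mul_smul_comm, smul_mul_assoc, one_mul, ← mul_assoc]
    module
  wu := by
    rw [sub_mul, h2]
    simp only [smul_sub, mul_add, mul_sub, mul_smul_comm, smul_mul_assoc, mul_one, ← mul_assoc]
    module
  du := by abel

lemma exists_inMonolith {M : Type} [AddCommGroup M] [Module A M] {V : Submodule A M}
    [IsSimpleModule A V] (hV : ∀ N : Submodule A M, N ≠ ⊥ → N ⊓ V ≠ ⊥) :
    ∃ v : M, InMonolith A v := by
  have hatom : IsAtom V := isSimpleModule_iff_isAtom.1 inferInstance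
  obtain ⟨v, hvV, hv⟩ := V.ne_bot_iff.1 hatom.1
  refine ⟨v, hv, fun x hx => ?_⟩
  have h1 : A ∙ x ≠ ⊥ := by simpa using hx
  have h2 : V ≤ A ∙ x :=
    inf_eq_right.1 ((hatom.le_iff.1 inf_le_right).resolve_left (hV _ h1))
  exact Submodule.mem_span_singleton.1 (h2 hvV)

theorem DownUpTriple.isArtinian {d u w : A} {r γ : K} {n : ℕ} (R : DownUpTriple d u w r γ)
    (hn : 0 < n) (hr : IsPrimitiveRoot r n) (hgen : Algebra.adjoin K {d, u} = ⊤)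
    {M : Type} [AddCommGroup M] [Module A M] [Module.Finite A M] {v : M} (hv : InMonolith A v) :
    IsArtinian A M := by
  let : Module K M := Module.compHom M (algebraMap K A)
  have : IsScalarTower K A M := ⟨fun c a x => by
    rw [Algebra.smul_def, mul_smul]
    rfl⟩
  obtain ⟨p, _⟩ := CharP.exists K
  by_cases hp : p = 0
  · subst hp
    have := CharP.charP_to_charZero K
    by_cases h1 : r = 1
    · subst h1
      by_cases hγ : γ = 0
      · exact R.isArtinian_of_skew (a := 0) (by simp [hγ]) hn hr hgen hv
      · exact R.isArtinian_of_casimir hγ hgen hv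
    · have h2 : (r - 1) ^ 2 ≠ 0 := pow_ne_zero 2 (sub_ne_zero.2 h1)
      exact R.isArtinian_of_skew (mul_div_cancel₀ γ h2).symm hn hr hgen hv
  · exact R.isArtinian_of_charP hp hn hr.pow_eq_one hgen hv

end LeadingTerm

namespace DownUpAlgebra

variable (K : Type) [Field K] (α β γ : K)

lemma d_mul_d_mul_u : d K α β γ * d K α β γ * u K α β γ =
    α • (d K α β γ * u K α β γ * d K α β γ) + β • (u K α β γ * d K α β γ * d K α β γ) +
      γ • d K α β γ := by
  simpa only [d, u, map_mul, map_add, map_smul] using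
    RingQuot.mkAlgHom_rel K (DownUpRel.rel1 (K := K) (α := α) (β := β) (γ := γ))

lemma d_mul_u_mul_u : d K α β γ * u K α β γ * u K α β γ =
    α • (u K α β γ * d K α β γ * u K α β γ) + β • (u K α β γ * u K α β γ * d K α β γ) +
      γ • u K α β γ := by
  simpa only [d, u, map_mul, map_add, map_smul] using
    RingQuot.mkAlgHom_rel K (DownUpRel.rel2 (K := K) (α := α) (β := β) (γ := γ))

lemma adjoin_eq_top : Algebra.adjoin K {d K α β γ, u K α β γ} = ⊤ := by
  have h1 : ({d K α β γ, u K α β γ} : Set (DownUpAlgebra K α β γ)) =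
      RingQuot.mkAlgHom K (DownUpRel K α β γ) '' Set.range (ι K) := by
    ext x
    simp [Fin.exists_fin_two, d, u, eq_comm]
  rw [h1, ← AlgHom.map_adjoin, FreeAlgebra.adjoin_range_ι, Algebra.map_top,
    AlgHom.range_eq_top]
  exact RingQuot.mkAlgHom_surjective K _

end DownUpAlgebra

/-- Let `r` be a primitive `n`-th root of unity and `A = A(2r, -r², γ)` the down-up
algebra with `X² - αX - β = (X - r)²`.  Then every finitely generated essential
extension of a simple `A`-module is Artinian: if a finitely generated `A`-module `M`
has a simple submodule `V` meeting every nonzero submodule nontrivially, then `M` is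
Artinian (equivalently, every finitely generated monolithic `A`-module is Artinian). -/
theorem downUp_equal_roots_of_unity_diamond (K : Type) [Field K] (n : ℕ) (hn : 0 < n)
    (r : K) (hr : IsPrimitiveRoot r n) (γ : K) :
    ∀ (M : Type) [AddCommGroup M]
      [Module (DownUpAlgebra K (2 * r) (-(r ^ 2)) γ) M],
      Module.Finite (DownUpAlgebra K (2 * r) (-(r ^ 2)) γ) M →
      ∀ V : Submodule (DownUpAlgebra K (2 * r) (-(r ^ 2)) γ) M,
        IsSimpleModule (DownUpAlgebra K (2 * r) (-(r ^ 2)) γ) V →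
        (∀ N : Submodule (DownUpAlgebra K (2 * r) (-(r ^ 2)) γ) M, N ≠ ⊥ → N ⊓ V ≠ ⊥) →
        IsArtinian (DownUpAlgebra K (2 * r) (-(r ^ 2)) γ) M := by
  intro M _ _ _ V _ hV
  obtain ⟨v, hv⟩ := LeadingTerm.exists_inMonolith hV
  exact (LeadingTerm.downUpTriple_of_rel (DownUpAlgebra.d_mul_d_mul_u K _ _ γ)
    (DownUpAlgebra.d_mul_u_mul_u K _ _ γ)).isArtinian hn hr
      (DownUpAlgebra.adjoin_eq_top K _ _ γ) hv

end
end
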